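/- Let p be a prime, G a finite group, Z a normal subgroup of G, and λ an irreducible complex character of Z that is G-invariant and such that o(λ)·λ(1) is not divisible by p. Assume that G/Z is p-solvable and that O_{p'}(G/Z) = 1. Assume furthermore the following large-orbit property: for every finite group H possessing a nontrivial normal p-complement K and a Sylow p-subgroup P, and every finite faithful completely reducible F H-module V over a field F of characteristic p, there exists v ∈ V fixed by P such that |C_K(v)|² < |K|. If there exists an integer d such that χ(1) = d for every irreducible complex character χ of G lying over λ whose degree χ(1) is not divisible by p, then G/Z is a p-group. -/

import Mathlib

/-- The determinantal order `o(λ)` of a representation `ρ` of `Z`: the least `o > 0`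
with `(det ρ z)^o = 1` for all `z` (the order of the linear character `det ∘ ρ`). -/
noncomputable def detOrder {Z : Type*} [Group Z] {W : Type*} [AddCommGroup W]
    [Module ℂ W] (ρ : Representation ℂ Z W) : ℕ :=
  sInf {o : ℕ | 0 < o ∧ ∀ z : Z, LinearMap.det (ρ z) ^ o = 1}

/-- A group is `p`-solvable if it has a subnormal series each of whose factors is
either a `p`-group or a `p'`-group (for finite groups this is equivalent to every
composition factor being a `p`-group or a `p'`-group). -/
def IsPSolvableGroup (p : ℕ) (X : Type*) [Group X] : Prop :=
  ∃ (k : ℕ) (H : Fin (k + 1) → Subgroup X), Monotone H ∧ H 0 = ⊥ ∧ H (Fin.last k) = ⊤ ∧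
    ∀ i : Fin k, ((H i.castSucc).subgroupOf (H i.succ)).Normal ∧
      ((∃ a : ℕ, (H i.castSucc).relIndex (H i.succ) = p ^ a) ∨
        ¬ p ∣ (H i.castSucc).relIndex (H i.succ))

/-- A nonzero complex representation whose commuting algebra consists of scalars. -/
def IsSchur {G V : Type*} [Group G] [AddCommGroup V] [Module ℂ V]
    (ρ : Representation ℂ G V) : Prop :=
  Nontrivial V ∧ ∀ A : Module.End ℂ V, (∀ g, A * ρ g = ρ g * A) → ∃ c : ℂ, A = c • 1

section Schur

variable {G V : Type*} [Group G] [AddCommGroup V] [Module ℂ V]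

theorem IsSchur.of_isIrreducible [FiniteDimensional ℂ V] {ρ : Representation ℂ G V}
    (h : ρ.IsIrreducible) : IsSchur ρ := by
  have hV : Nontrivial V := by
    by_contra hn
    rw [not_nontrivial_iff_subsingleton] at hn
    have := h.toNontrivial
    obtain ⟨a, b, hab⟩ := this
    refine hab ?_
    have : a.toSubmodule = b.toSubmodule := Subsingleton.elim _ _
    cases a; cases b; simpa using this
  refine ⟨hV, fun A hA => ?_⟩
  obtain ⟨c, hc⟩ :=
    (Representation.IsIrreducible.algebraMap_intertwiningMap_bijective_of_isAlgClosed
      (ρ := ρ)).2 ⟨A, hA⟩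
  refine ⟨c, ?_⟩
  have := congrArg Representation.IntertwiningMap.toLinearMap hc
  simp only at this
  rw [← this]
  ext x
  rfl

theorem IsSchur.isIrreducible [Finite G] {ρ : Representation ℂ G V}
    (h : IsSchur ρ) : ρ.IsIrreducible := by
  have := h.1
  refine { exists_pair_ne := ⟨⊥, ⊤, ?_⟩, eq_bot_or_eq_top := fun U => ?_ }
  · intro hbt
    have := congrArg Subrepresentation.toSubmodule hbt
    exact bot_ne_top (α := Submodule ℂ V) this
  · obtain ⟨U', hU⟩ := exists_isCompl U
    have hc : IsCompl U.toSubmodule U'.toSubmodule := by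
      refine ⟨disjoint_iff.2 ?_, codisjoint_iff.2 ?_⟩
      · rw [← Subrepresentation.toSubmodule_inf, hU.inf_eq_bot]; rfl
      · rw [← Subrepresentation.toSubmodule_sup, hU.sup_eq_top]; rfl
    obtain ⟨c, hcE⟩ := h.2 (U.toSubmodule.projection U'.toSubmodule hc) (fun g => by
      ext v
      obtain ⟨a, ha, b, hb, rfl⟩ := Submodule.mem_sup.1
        (hc.sup_eq_top ▸ Submodule.mem_top : v ∈ U.toSubmodule ⊔ U'.toSubmodule)
      have h1 := U.apply_mem_toSubmodule g ha
      have h2 := U'.apply_mem_toSubmodule g hb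
      simp [Submodule.projection_apply_of_mem_left hc ha,
        Submodule.projection_apply_of_mem_left hc h1,
        Submodule.projection_apply_of_mem_right hc hb,
        Submodule.projection_apply_of_mem_right hc h2])
    by_cases h0 : c = 0
    · left
      apply Subrepresentation.toSubmodule_injective
      rw [← Submodule.range_projection hc, hcE, h0, zero_smul]
      exact LinearMap.range_zero
    · right
      apply Subrepresentation.toSubmodule_injective
      rw [← Submodule.range_projection hc, hcE]
      refine (LinearMap.range_eq_top.2 fun v => ⟨c⁻¹ • v, ?_⟩).trans rfl
      simp [h0]

theorem IsSchur.isSimpleModule [Finite G] {ρ : Representation ℂ G V}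
    (h : IsSchur ρ) : IsSimpleModule (MonoidAlgebra ℂ G) ρ.asModule :=
  (Representation.irreducible_iff_isSimpleModule_asModule ρ).1 h.isIrreducible

theorem IsSchur.of_isSimpleModule [FiniteDimensional ℂ V] {ρ : Representation ℂ G V}
    (h : IsSimpleModule (MonoidAlgebra ℂ G) ρ.asModule) : IsSchur ρ :=
  .of_isIrreducible ((Representation.irreducible_iff_isSimpleModule_asModule ρ).2 h)

theorem IsSchur.isUnit_of_ne_zero [Finite G] {ρ σ : Representation ℂ G V}
    (hρ : IsSchur ρ) (hσ : IsSchur σ) {A : Module.End ℂ V}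
    (hA : ∀ g, A * ρ g = σ g * A) (h0 : A ≠ 0) : IsUnit A := by
  have := hρ.isIrreducible
  have := hσ.isIrreducible
  rw [Module.End.isUnit_iff]
  rcases Representation.IsIrreducible.bijective_or_eq_zero
    (⟨A, hA⟩ : Representation.IntertwiningMap ρ σ) with h | h
  · exact h
  · exact absurd (congrArg Representation.IntertwiningMap.toLinearMap h) h0

end Schur

section Tensor

open TensorProduct

variable {W X : Type*} [AddCommGroup W] [Module ℂ W] [AddCommGroup X] [Module ℂ X]

theorem TensorProduct.eq_of_forall_lTensor_dual (t s : W ⊗[ℂ] X)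
    (h : ∀ ξ : Module.Dual ℂ X, ξ.lTensor W t = ξ.lTensor W s) : t = s := by
  classical
  let b := Module.Basis.ofVectorSpace ℂ X
  have key : ∀ (u : W ⊗[ℂ] X) (i), TensorProduct.equivFinsuppOfBasisRight b u i =
      TensorProduct.rid ℂ W ((b.coord i).lTensor W u) := by
    intro u i
    induction u with
    | zero => simp
    | tmul w x => simp
    | add x y hx hy => simp only [map_add, Finsupp.add_apply, hx, hy]
  apply (TensorProduct.equivFinsuppOfBasisRight b).injective
  ext i
  rw [key, key, h]

/-- The component of an endomorphism of `W ⊗ X` at a vector and a functional of `X`. -/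
noncomputable def tensorComponent (Φ : Module.End ℂ (W ⊗[ℂ] X)) (x : X) (ξ : Module.Dual ℂ X) :
    Module.End ℂ W :=
  (TensorProduct.rid ℂ W).toLinearMap ∘ₗ ξ.lTensor W ∘ₗ Φ ∘ₗ (TensorProduct.mk ℂ W X).flip x

theorem tensorComponent_apply (Φ : Module.End ℂ (W ⊗[ℂ] X)) (x : X) (ξ : Module.Dual ℂ X) (w : W) :
    tensorComponent Φ x ξ w = TensorProduct.rid ℂ W (ξ.lTensor W (Φ (w ⊗ₜ x))) := rfl

theorem tensorComponent_intertwines {Φ : Module.End ℂ (W ⊗[ℂ] X)} {a b : Module.End ℂ W}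
    (h : Φ * TensorProduct.map a LinearMap.id = TensorProduct.map b LinearMap.id * Φ)
    (x : X) (ξ : Module.Dual ℂ X) :
    tensorComponent Φ x ξ * a = b * tensorComponent Φ x ξ := by
  ext w
  have h1 := LinearMap.congr_fun h (w ⊗ₜ x)
  have h2 : ∀ t : W ⊗[ℂ] X, TensorProduct.rid ℂ W (ξ.lTensor W (TensorProduct.map b LinearMap.id t))
      = b (TensorProduct.rid ℂ W (ξ.lTensor W t)) := by
    intro t
    induction t with
    | zero => simp
    | tmul w x => simp
    | add x y hx hy => simp only [map_add, hx, hy]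
  simp only [Module.End.mul_apply, TensorProduct.map_tmul, LinearMap.id_apply] at h1 ⊢
  rw [tensorComponent_apply, h1, h2, tensorComponent_apply]

/-- If no nonzero endomorphism intertwines two representations on `W`, then none intertwines their
inflations to `W ⊗ X`. -/
theorem tensor_intertwiner_eq_zero {ι : Type*} {a b : ι → Module.End ℂ W}
    (hab : ∀ B : Module.End ℂ W, (∀ i, B * a i = b i * B) → B = 0)
    {Φ : Module.End ℂ (W ⊗[ℂ] X)}
    (h : ∀ i, Φ * TensorProduct.map (a i) LinearMap.id =
      TensorProduct.map (b i) LinearMap.id * Φ) : Φ = 0 := by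
  apply TensorProduct.ext'
  intro w x
  apply TensorProduct.eq_of_forall_lTensor_dual
  intro ξ
  have := hab _ fun i => tensorComponent_intertwines (h i) x ξ
  apply (TensorProduct.rid ℂ W).injective
  rw [← tensorComponent_apply, this]
  simp

theorem IsSchur.exists_eq_map_id {Z : Type*} [Group Z] {lam : Representation ℂ Z W}
    (hlam : IsSchur lam) {Φ : Module.End ℂ (W ⊗[ℂ] X)}
    (h : ∀ z, Φ * TensorProduct.map (lam z) LinearMap.id =
      TensorProduct.map (lam z) LinearMap.id * Φ) :
    ∃ Ψ : Module.End ℂ X, Φ = TensorProduct.map LinearMap.id Ψ := by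
  obtain ⟨hW, hS⟩ := hlam
  have hc := fun x ξ => hS _ fun z => tensorComponent_intertwines (h z) x ξ
  choose c hc using hc
  obtain ⟨w₀, hw₀⟩ := exists_ne (0 : W)
  obtain ⟨η, hη⟩ := Module.Projective.exists_dual_eq_one ℂ hw₀
  have hsw : ∀ (ξ : Module.Dual ℂ X) (t : W ⊗[ℂ] X),
      ξ (TensorProduct.lid ℂ X (η.rTensor X t)) = η (TensorProduct.rid ℂ W (ξ.lTensor W t)) := by
    intro ξ t
    induction t with
    | zero => simp
    | tmul w x => simp [mul_comm]
    | add x y hx hy => simp only [map_add, hx, hy]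
  refine ⟨(TensorProduct.lid ℂ X).toLinearMap ∘ₗ η.rTensor X ∘ₗ Φ ∘ₗ TensorProduct.mk ℂ W X w₀,
    TensorProduct.ext' fun w x => TensorProduct.eq_of_forall_lTensor_dual _ _ fun ξ => ?_⟩
  apply (TensorProduct.rid ℂ W).injective
  rw [← tensorComponent_apply, hc]
  have : ξ (TensorProduct.lid ℂ X (η.rTensor X (Φ (w₀ ⊗ₜ[ℂ] x)))) = c x ξ := by
    rw [hsw, ← tensorComponent_apply, hc]
    simp [hη]
  simp [this]

end Tensor

section Coinduced

variable {G U : Type*} [Group G] [AddCommGroup U] [Module ℂ U]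

theorem finrank_coindV [Finite G] [FiniteDimensional ℂ U] (J : Subgroup G) (Y : Representation ℂ J U) :
    Module.finrank ℂ (Representation.coindV J.subtype Y) = J.index * Module.finrank ℂ U := by
  classical
  let q : G → Quotient (QuotientGroup.rightRel J) := Quotient.mk _
  have hout : ∀ g : G, g * (q g).out⁻¹ ∈ J := fun g => by
    have := Quotient.mk_out (s := QuotientGroup.rightRel J) g
    exact QuotientGroup.rightRel_apply.1 this
  have hq : ∀ (j : J) (g : G), q (j * g) = q g := fun j g =>
    Quotient.sound (QuotientGroup.rightRel_apply.2 (by simp))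
  let e : Representation.coindV J.subtype Y →ₗ[ℂ] (Quotient (QuotientGroup.rightRel J) → U) :=
    { toFun := fun F c => F.1 c.out
      map_add' := fun _ _ => rfl
      map_smul' := fun _ _ => rfl }
  have he : Function.Bijective e := by
    constructor
    · intro F F' h
      ext g
      have h1 := congrFun h (q g)
      have h2 := F.2 ⟨_, hout g⟩ (q g).out
      have h3 := F'.2 ⟨_, hout g⟩ (q g).out
      simp only [Subgroup.coe_subtype, inv_mul_cancel_right] at h2 h3
      rw [h2, h3]
      exact congrArg _ h1
    · intro u
      refine ⟨⟨fun g => Y ⟨_, hout g⟩ (u (q g)), fun j g => ?_⟩, ?_⟩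
      · simp only [Subgroup.coe_subtype, hq]
        rw [← Module.End.mul_apply, ← map_mul]
        congr 2
        ext
        simp [mul_assoc]
      · funext c
        have : q c.out = c := Quotient.out_eq c
        have h2 : (⟨_, hout c.out⟩ : J) = 1 := by ext; simp [this]
        change Y ⟨_, hout c.out⟩ (u (q c.out)) = u c
        rw [h2, this]
        simp
  have := Fintype.ofFinite (Quotient (QuotientGroup.rightRel J))
  rw [(LinearEquiv.ofBijective e he).finrank_eq, Module.finrank_pi_fintype, Finset.sum_const,
    Finset.card_univ, smul_eq_mul, ← Nat.card_eq_fintype_card,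
    Nat.card_congr (QuotientGroup.quotientRightRelEquivQuotientLeftRel J), Subgroup.index]

instance [Finite G] [FiniteDimensional ℂ U] (J : Subgroup G) (Y : Representation ℂ J U) :
    FiniteDimensional ℂ (Representation.coindV J.subtype Y) := by
  have := Fintype.ofFinite G
  infer_instance

open Classical in
/-- The function supported on `J` with value `y` at `1`. -/
noncomputable def coindSingle (J : Subgroup G) (Y : Representation ℂ J U) :
    U →ₗ[ℂ] Representation.coindV J.subtype Y where
  toFun y := ⟨fun g => if h : g ∈ J then Y ⟨g, h⟩ y else 0, fun j g => by
    by_cases h : g ∈ J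
    · beta_reduce
      rw [dif_pos h, dif_pos (show J.subtype j * g ∈ J from J.mul_mem j.2 h), ← Module.End.mul_apply,
        ← map_mul]
      rfl
    · have : (j : G) * g ∉ J := fun h' => h ((J.mul_mem_cancel_left j.2).1 h')
      simp [h, this]⟩
  map_add' y y' := by
    ext g
    by_cases h : g ∈ J <;> simp [h]
  map_smul' c y := by
    ext g
    by_cases h : g ∈ J <;> simp [h]

theorem coindSingle_of_mem (J : Subgroup G) (Y : Representation ℂ J U) (y : U) {g : G}
    (h : g ∈ J) : (coindSingle J Y y).1 g = Y ⟨g, h⟩ y := by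
  simp [coindSingle, h]

theorem coindSingle_of_notMem (J : Subgroup G) (Y : Representation ℂ J U) (y : U) {g : G}
    (h : g ∉ J) : (coindSingle J Y y).1 g = 0 := by
  simp [coindSingle, h]

theorem coind_coindSingle (J : Subgroup G) (Y : Representation ℂ J U) (y : U) (j : J) :
    Representation.coind J.subtype Y j (coindSingle J Y y) = coindSingle J Y (Y j y) := by
  ext g
  change (coindSingle J Y y).1 (g * j) = _
  by_cases h : g ∈ J
  · rw [coindSingle_of_mem _ _ _ (J.mul_mem h j.2), coindSingle_of_mem _ _ _ h,
      ← Module.End.mul_apply, ← map_mul]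
    rfl
  · rw [coindSingle_of_notMem _ _ _ h, coindSingle_of_notMem]
    exact fun h' => h ((J.mul_mem_cancel_right j.2).1 h')

theorem sum_coind_coindSingle [Fintype G] (J : Subgroup G) (Y : Representation ℂ J U)
    (F : Representation.coindV J.subtype Y) :
    ∑ g : G, Representation.coind J.subtype Y g⁻¹ (coindSingle J Y (F.1 g)) =
      (Nat.card J : ℂ) • F := by
  classical
  ext h
  have : ∀ g : G, (coindSingle J Y (F.1 g)).1 (h * g⁻¹) = if h * g⁻¹ ∈ J then F.1 h else 0 := by
    intro g
    split_ifs with hg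
    · rw [coindSingle_of_mem _ _ _ hg, ← F.2]
      simp
    · rw [coindSingle_of_notMem _ _ _ hg]
  rw [AddSubmonoidClass.coe_finsetSum, Finset.sum_apply]
  change ∑ g : G, (coindSingle J Y (F.1 g)).1 (h * g⁻¹) = (Nat.card J : ℂ) • F.1 h
  simp_rw [this]
  rw [← Equiv.sum_comp ((Equiv.inv G).trans (Equiv.mulRight h))]
  simp only [Equiv.trans_apply, Equiv.inv_apply, Equiv.coe_mulRight, mul_inv_rev, inv_inv,
    mul_inv_cancel_left]
  rw [← Finset.sum_filter, Finset.sum_const, ← Nat.cast_smul_eq_nsmul ℂ, Nat.card_eq_fintype_card,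
    Fintype.card_subtype]

/-- **Mackey's criterion**: a sufficient condition for a coinduced representation to be
irreducible. -/
theorem IsSchur.coind [Finite G] (J : Subgroup G) {Y : Representation ℂ J U}
    (hY : IsSchur Y)
    (hM : ∀ g ∉ J, ∀ B : Module.End ℂ U, (∀ (x : G) (hx : x ∈ J) (hgx : g * x * g⁻¹ ∈ J),
      B * Y ⟨x, hx⟩ = Y ⟨g * x * g⁻¹, hgx⟩ * B) → B = 0) :
    IsSchur (Representation.coind J.subtype Y) := by
  have := Fintype.ofFinite G
  obtain ⟨hU, hS⟩ := hY
  constructor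
  · obtain ⟨y, hy⟩ := exists_ne (0 : U)
    refine ⟨coindSingle J Y y, 0, fun h => hy ?_⟩
    have := congrArg (fun F => F.1 1) h
    simp only [coindSingle_of_mem _ _ _ J.one_mem] at this
    rw [show (⟨1, J.one_mem⟩ : J) = 1 from rfl, map_one] at this
    simpa using this
  intro Φ hΦ
  have hΦ' : ∀ g F, Φ (Representation.coind J.subtype Y g F) =
      Representation.coind J.subtype Y g (Φ F) := fun g F => LinearMap.congr_fun (hΦ g) F
  let B : G → Module.End ℂ U := fun g =>
    (LinearMap.proj g) ∘ₗ (Representation.coindV J.subtype Y).subtype ∘ₗ Φ ∘ₗ coindSingle J Y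
  have hBapp : ∀ g y, B g y = (Φ (coindSingle J Y y)).1 g := fun _ _ => rfl
  have hB1 : ∀ (j : J) g, B (j * g) = Y j * B g := fun j g => by
    ext y
    exact (Φ (coindSingle J Y y)).2 j g
  have hB2 : ∀ (j : J) g, B g * Y j = B (g * j) := fun j g => by
    ext y
    rw [Module.End.mul_apply, hBapp, ← coind_coindSingle, hΦ']
    rfl
  have hB0 : ∀ g ∉ J, B g = 0 := fun g hg => hM g hg _ fun x hx hgx => by
    rw [hB2 ⟨x, hx⟩, ← hB1 ⟨_, hgx⟩]
    simp
  obtain ⟨c, hc⟩ := hS (B 1) fun j => by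
    rw [hB2, ← hB1]
    simp
  have hsingle : ∀ y, Φ (coindSingle J Y y) = c • coindSingle J Y y := fun y => by
    ext g
    rw [← hBapp]
    change _ = c • (coindSingle J Y y).1 g
    by_cases hg : g ∈ J
    · have := hB1 ⟨g, hg⟩ 1
      rw [mul_one, hc] at this
      rw [coindSingle_of_mem _ _ _ hg, this]
      simp
    · rw [hB0 g hg, coindSingle_of_notMem _ _ _ hg]
      simp
  refine ⟨c, LinearMap.ext fun F => ?_⟩
  have hJ : (Nat.card J : ℂ) ≠ 0 := Nat.cast_ne_zero.2 Nat.card_pos.ne'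
  have h1 := sum_coind_coindSingle J Y F
  have h2 := congrArg Φ h1
  rw [map_sum, map_smul] at h2
  simp_rw [hΦ', hsingle, map_smul] at h2
  rw [← Finset.smul_sum, h1, smul_comm] at h2
  exact (smul_right_injective _ hJ h2).symm

end Coinduced

/-- Every prime divisor of `n` lies in `π`. -/
def IsPiNum (π : Set ℕ) (n : ℕ) : Prop := ∀ q : ℕ, q.Prime → q ∣ n → q ∈ π

section PiCore

variable {π : Set ℕ} {p : ℕ}

theorem IsPiNum.of_dvd {m n : ℕ} (h : IsPiNum π n) (hmn : m ∣ n) : IsPiNum π m :=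
  fun q hq hqm => h q hq (hqm.trans hmn)

theorem IsPiNum.mul {m n : ℕ} (hm : IsPiNum π m) (hn : IsPiNum π n) : IsPiNum π (m * n) :=
  fun q hq hqm => (hq.dvd_mul.1 hqm).elim (hm q hq) (hn q hq)

theorem isPiNum_compl_singleton (hp : p.Prime) {n : ℕ} : IsPiNum {p}ᶜ n ↔ ¬ p ∣ n := by
  refine ⟨fun h hd => h p hp hd rfl, fun h q _ hqn hqp => h ?_⟩
  rw [Set.mem_singleton_iff] at hqp
  rwa [← hqp]

theorem isPiNum_singleton_pow (hp : p.Prime) (a : ℕ) : IsPiNum {p} (p ^ a) :=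
  fun _ hq hd => (Nat.prime_dvd_prime_iff_eq hq hp).1 (hq.dvd_of_dvd_pow hd)

theorem isPiNum_singleton_card (hp : p.Prime) {X : Type*} [Group X] [Finite X] :
    IsPiNum {p} (Nat.card X) ↔ IsPGroup p X := by
  have := Fact.mk hp
  rw [IsPGroup.iff_card]
  constructor
  · intro h
    exact ⟨_, Nat.eq_prime_pow_of_unique_prime_dvd Nat.card_pos.ne' fun {q} hq hd => h q hq hd⟩
  · rintro ⟨a, ha⟩
    rw [ha]
    exact isPiNum_singleton_pow hp a

theorem isPiNum_card_of_forall_pow {X : Type*} [Group X] [Finite X] {n : ℕ} (hn : IsPiNum π n)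
    (h : ∀ x : X, x ^ n = 1) : IsPiNum π (Nat.card X) := by
  intro q hq hd
  have := Fact.mk hq
  obtain ⟨x, hx⟩ := exists_prime_orderOf_dvd_card' (G := X) q hd
  exact hn q hq (hx ▸ orderOf_dvd_of_pow_eq_one (h x))

variable (π) in
/-- The subgroup generated by all normal `π`-subgroups. -/
def piCore (X : Type*) [Group X] : Subgroup X :=
  sSup {N : Subgroup X | N.Normal ∧ IsPiNum π (Nat.card N)}

variable {X : Type*} [Group X]

theorem le_piCore {N : Subgroup X} (hN : N.Normal) (h : IsPiNum π (Nat.card N)) :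
    N ≤ piCore π X :=
  le_sSup ⟨hN, h⟩

theorem piCore_mem [Finite X] : (piCore π X).Normal ∧ IsPiNum π (Nat.card (piCore π X)) := by
  let S := {N : Subgroup X | N.Normal ∧ IsPiNum π (Nat.card N)}
  have hne : S.Nonempty := ⟨⊥, inferInstance, by
    rw [Subgroup.card_bot]
    intro q hq hd
    exact absurd (Nat.dvd_one.1 hd) hq.one_lt.ne'⟩
  obtain ⟨M, hM⟩ := (Set.toFinite S).exists_maximal hne
  have hle : ∀ N ∈ S, N ≤ M := by
    intro N hN
    have hMn := hM.1.1
    have hNn := hN.1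
    have : M ⊔ N ∈ S := by
      refine ⟨inferInstance, ?_⟩
      have h1 := Subgroup.card_mul_index (M.subgroupOf (M ⊔ N))
      rw [Nat.card_congr (Subgroup.subgroupOfEquivOfLe (le_sup_left : M ≤ M ⊔ N)).toEquiv] at h1
      rw [← h1]
      refine hM.1.2.mul ?_
      change IsPiNum π (M.relIndex (M ⊔ N))
      rw [sup_comm, Subgroup.relIndex_sup_right]
      exact hN.2.of_dvd (Subgroup.relIndex_dvd_card M N)
    exact le_sup_right.trans (hM.2 this le_sup_left)
  have : piCore π X = M := le_antisymm (sSup_le hle) (le_sSup hM.1)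
  rw [this]
  exact hM.1

instance piCore_normal [Finite X] : (piCore π X).Normal := piCore_mem.1

theorem isPiNum_card_piCore [Finite X] : IsPiNum π (Nat.card (piCore π X)) := piCore_mem.2

theorem map_piCore_le_of_mulEquiv [Finite X] {Y : Type*} [Group Y] (e : X ≃* Y) :
    (piCore π X).map e.toMonoidHom ≤ piCore π Y := by
  refine le_piCore (Subgroup.Normal.map piCore_normal _ e.surjective) ?_
  rw [Subgroup.card_map_of_injective e.injective]
  exact isPiNum_card_piCore

instance piCore_characteristic [Finite X] : (piCore π X).Characteristic :=
  Subgroup.characteristic_iff_map_le.2 map_piCore_le_of_mulEquiv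

theorem piCore_eq_bot_of_mulEquiv [Finite X] {Y : Type*} [Group Y] (e : X ≃* Y)
    (h : piCore π Y = ⊥) : piCore π X = ⊥ := by
  have := map_piCore_le_of_mulEquiv (π := π) e
  rw [h, le_bot_iff, Subgroup.map_eq_bot_iff_of_injective _ e.injective] at this
  exact this

theorem map_piCore_subtype_le [Finite X] (N : Subgroup X) [N.Normal] :
    (piCore π N).map N.subtype ≤ piCore π X := by
  refine le_piCore inferInstance ?_
  rw [Subgroup.card_map_of_injective N.subtype_injective]
  exact isPiNum_card_piCore

theorem piCore_subgroup_eq_bot [Finite X] (N : Subgroup X) [N.Normal] (h : piCore π X = ⊥) :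
    piCore π N = ⊥ := by
  have := map_piCore_subtype_le (π := π) N
  rwa [h, le_bot_iff, Subgroup.map_eq_bot_iff_of_injective _ N.subtype_injective] at this

theorem piCore_eq_top [Finite X] (h : IsPiNum π (Nat.card X)) : piCore π X = ⊤ :=
  top_le_iff.1 (le_piCore inferInstance (by rwa [Subgroup.card_top]))

/-- Every nontrivial section of `X` has a nontrivial normal subgroup which is either a `p`-group
or a `p'`-group. -/
def HasPiSections (p : ℕ) (X : Type*) [Group X] : Prop :=
  ∀ (Y : Subgroup X) (A : Type) [Group A] (f : Y →* A), Function.Surjective f → Nontrivial A →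
    piCore {p} A ≠ ⊥ ∨ piCore {p}ᶜ A ≠ ⊥

theorem HasPiSections.of_injective (h : HasPiSections p X) {Y : Type*} [Group Y] (i : Y →* X)
    (hi : Function.Injective i) : HasPiSections p Y := by
  intro T A _ f hf hA
  exact h (T.map i) A (f.comp (T.equivMapOfInjective i hi).symm.toMonoidHom)
    (hf.comp (T.equivMapOfInjective i hi).symm.surjective) hA

theorem HasPiSections.of_surjective (h : HasPiSections p X) {Y : Type*} [Group Y] (i : X →* Y)
    (hi : Function.Surjective i) : HasPiSections p Y := by
  intro T A _ f hf hA
  refine h (T.comap i) A (f.comp (i.subgroupComap T)) (hf.comp ?_) hA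
  exact i.subgroupComap_surjective_of_surjective T hi

theorem HasPiSections.piCore_ne_bot {X : Type} [Group X] [Nontrivial X] (h : HasPiSections p X) :
    piCore {p} X ≠ ⊥ ∨ piCore {p}ᶜ X ≠ ⊥ :=
  h ⊤ X (Subgroup.topEquiv (G := X)).toMonoidHom Subgroup.topEquiv.surjective inferInstance

end PiCore

section PSolvable

variable {p : ℕ}

theorem IsPSolvableGroup.hasPiSections (hp : p.Prime) {X : Type*} [Group X] [Finite X]
    (h : IsPSolvableGroup p X) : HasPiSections p X := by
  obtain ⟨k, H, hmono, h0, h1, hstep⟩ := h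
  intro Y A _ f hf hA
  have hAfin : Finite A := Finite.of_surjective f hf
  let L : Fin (k + 1) → Subgroup A := fun i => ((H i).subgroupOf Y).map f
  have hL : ∀ i, L i ≠ ⊥ → piCore {p} (L i) ≠ ⊥ ∨ piCore {p}ᶜ (L i) ≠ ⊥ := by
    intro i
    induction i using Fin.induction with
    | zero => simp [L, h0]
    | succ i ih =>
      intro hne
      obtain ⟨hn, hidx⟩ := hstep i
      have hle : H i.castSucc ≤ H i.succ := hmono (Fin.castSucc_lt_succ).le
      rw [Subgroup.normal_subgroupOf_iff hle] at hn
      by_cases hbot : L i.castSucc = ⊥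
      · have hpow : ∀ x : L i.succ, x ^ (H i.castSucc).relIndex (H i.succ) = 1 := by
          rintro ⟨_, y, hy, rfl⟩
          ext
          have h2 : (y : X) ^ (H i.castSucc).relIndex (H i.succ) ∈ H i.castSucc := by
            have := (Subgroup.normal_subgroupOf_iff hle).2 hn
            exact Subgroup.pow_index_mem ((H i.castSucc).subgroupOf (H i.succ)) ⟨(y : X), hy⟩
          have h3 : f y ^ (H i.castSucc).relIndex (H i.succ) ∈ L i.castSucc :=
            ⟨y ^ (H i.castSucc).relIndex (H i.succ), h2, map_pow _ _ _⟩
          rw [hbot] at h3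
          exact h3
        have htop : (⊤ : Subgroup (L i.succ)) ≠ ⊥ := by
          intro h
          have := (Subgroup.nontrivial_iff_ne_bot _).2 hne
          exact top_ne_bot h
        rcases hidx with ⟨a, ha⟩ | hnd
        · left
          rw [piCore_eq_top (isPiNum_card_of_forall_pow (ha ▸ isPiNum_singleton_pow hp a) hpow)]
          exact htop
        · right
          rw [piCore_eq_top (isPiNum_card_of_forall_pow
            ((isPiNum_compl_singleton hp).2 hnd) hpow)]
          exact htop
      · have hLle : L i.castSucc ≤ L i.succ := Subgroup.map_mono fun y hy => hle hy
        have hLn : ((L i.castSucc).subgroupOf (L i.succ)).Normal := by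
          rw [Subgroup.normal_subgroupOf_iff hLle]
          rintro _ _ ⟨y, hy, rfl⟩ ⟨z, hz, rfl⟩
          exact ⟨z * y * z⁻¹, hn y z hy hz, by simp⟩
        have htr : ∀ π, piCore π (L i.castSucc) ≠ ⊥ → piCore π (L i.succ) ≠ ⊥ := by
          intro π hπ hb
          exact hπ (piCore_eq_bot_of_mulEquiv (Subgroup.subgroupOfEquivOfLe hLle).symm
            (piCore_subgroup_eq_bot _ hb))
        exact (ih hbot).imp (htr _) (htr _)
  have hlast : L (Fin.last k) = ⊤ := by
    simp [L, h1, ← MonoidHom.range_eq_map, MonoidHom.range_eq_top.2 hf]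
  have := hL (Fin.last k) (by rw [hlast]; exact top_ne_bot)
  rw [hlast] at this
  have htr : ∀ π, piCore π (⊤ : Subgroup A) ≠ ⊥ → piCore π A ≠ ⊥ := fun π h hb =>
    h (piCore_eq_bot_of_mulEquiv Subgroup.topEquiv hb)
  exact this.imp (htr _) (htr _)

variable {X : Type} [Group X] [Finite X]

theorem mul_pow_index_of_central {L : Type*} [Group L] [Finite L] (Z : Subgroup L)
    (hZ : Z ≤ Subgroup.center L) (a b : L) :
    (a * b) ^ Z.index = a ^ Z.index * b ^ Z.index := by
  let _ : CommGroup Z :=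
    { mul_comm := fun x y => Subtype.ext (Subgroup.mem_center_iff.1 (hZ y.2) x) }
  have hpow := fun g : L => (MonoidHom.id Z).transfer_eq_pow g (fun k g₀ hk => by
    have := Subgroup.mem_center_iff.1 (hZ hk) g₀
    simp only [← mul_assoc, mul_inv_cancel, one_mul] at this
    exact (mul_right_cancel this).symm)
  have h := map_mul (MonoidHom.id Z).transfer a b
  rw [hpow, hpow, hpow] at h
  exact congrArg Subtype.val h

/-- **Hall–Higman**. -/
theorem centralizer_piCore_le (hp : p.Prime) (hps : HasPiSections p X)
    (hop : piCore {p}ᶜ X = ⊥) :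
    Subgroup.centralizer (piCore {p} X : Set X) ≤ piCore {p} X := by
  set O := piCore {p} X with hO
  set C := Subgroup.centralizer (O : Set X)
  have hOp : IsPGroup p O := (isPiNum_singleton_card hp).1 isPiNum_card_piCore
  by_contra hCO
  let q := QuotientGroup.mk' O
  have hker : ∀ x, q x = 1 ↔ x ∈ O := fun x => QuotientGroup.eq_one_iff x
  have hCn : (C.map q).Normal := Subgroup.Normal.map inferInstance _ (QuotientGroup.mk'_surjective O)
  have hnt : Nontrivial (C.map q) := by
    obtain ⟨c, hc, hcO⟩ := SetLike.not_le_iff_exists.1 hCO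
    refine ⟨⟨q c, c, hc, rfl⟩, 1, fun h => hcO ?_⟩
    exact (hker c).1 (congrArg Subtype.val h)
  -- a nontrivial normal `π`-subgroup of `X / O` inside the image of `C` is impossible
  have key : ∀ M : Subgroup (X ⧸ O), M.Normal → M ≤ C.map q →
      (IsPiNum {p} (Nat.card M) ∨ IsPiNum {p}ᶜ (Nat.card M)) → M = ⊥ := by
    intro M hM hMC hπ
    have hL : M.comap q ⊓ C ≤ O := by
      rcases hπ with hπ | hπ
      · refine inf_le_left.trans (le_piCore inferInstance ?_)
        rw [isPiNum_singleton_card hp]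
        refine ((isPiNum_singleton_card hp).1 hπ).comap_of_ker_isPGroup q ?_
        rwa [QuotientGroup.ker_mk']
      · set L := M.comap q ⊓ C
        let t₀ : L →* X ⧸ O := q.comp L.subtype
        have hidx : ¬ p ∣ t₀.ker.index := by
          rw [← isPiNum_compl_singleton hp, Subgroup.index_ker]
          refine hπ.of_dvd (Subgroup.card_dvd_of_le ?_)
          rintro _ ⟨x, rfl⟩
          exact x.2.1
        have hcent : ∀ x : t₀.ker, ∀ y : L, y * x = x * y := by
          intro x y
          ext
          have hx : (x : X) ∈ O := (hker _).1 x.2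
          exact (Subgroup.mem_centralizer_iff.1 y.2.2 _ hx).symm
        set m := t₀.ker.index
        have hmul := fun a b : L => mul_pow_index_of_central t₀.ker
          (fun x hx => Subgroup.mem_center_iff.2 fun y => hcent ⟨x, hx⟩ y) a b
        let τ : L →* L :=
          { toFun := fun a => a ^ m
            map_one' := one_pow m
            map_mul' := hmul }
        have hE : τ.ker.map L.subtype = ⊥ := by
          rw [← le_bot_iff, ← hop]
          refine le_piCore ⟨?_⟩ ?_
          · rintro _ ⟨e, he, rfl⟩ x
            have hLn : L.Normal := inferInstance
            refine ⟨⟨x * e * x⁻¹, hLn.conj_mem _ e.2 x⟩, ?_, rfl⟩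
            have h1 : (e : X) ^ m = 1 := congrArg Subtype.val (show e ^ m = 1 from he)
            change (⟨x * e * x⁻¹, hLn.conj_mem _ e.2 x⟩ : L) ^ m = 1
            ext
            simp [conj_pow, h1]
          · rw [Subgroup.card_map_of_injective L.subtype_injective]
            refine isPiNum_card_of_forall_pow ((isPiNum_compl_singleton hp).2 hidx) fun x => ?_
            ext
            exact congrArg Subtype.val (show (x : L) ^ m = 1 from x.2)
        rw [Subgroup.map_eq_bot_iff_of_injective _ L.subtype_injective] at hE
        have hLn : L.Normal := inferInstance
        refine le_piCore hLn ((isPiNum_singleton_card hp).2 fun g => ?_)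
        have hg : ((g ^ m : L) : X) ∈ O := (hker _).1 (t₀.ker.pow_index_mem g)
        obtain ⟨a, ha⟩ := hOp ⟨_, hg⟩
        have ha' : (g ^ m) ^ p ^ a = 1 := by
          ext
          simpa using congrArg (Subtype.val : O → X) ha
        refine ⟨a, ?_⟩
        have h3 : g ^ p ^ a ∈ τ.ker := by
          change (g ^ p ^ a) ^ m = 1
          rw [← pow_mul, mul_comm, pow_mul, ha']
        rw [hE] at h3
        exact h3
    rw [eq_bot_iff]
    intro y hy
    obtain ⟨c, hc, rfl⟩ := hMC hy
    exact (hker c).2 (hL ⟨hy, hc⟩)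
  have key' : ∀ π, π = {p} ∨ π = {p}ᶜ → piCore π (C.map q) = ⊥ := by
    intro π hπ
    rw [← Subgroup.map_eq_bot_iff_of_injective _ (C.map q).subtype_injective]
    refine key _ ConjAct.normal_of_characteristic_of_normal (Subgroup.map_subtype_le _) ?_
    rw [Subgroup.card_map_of_injective (C.map q).subtype_injective]
    rcases hπ with rfl | rfl
    · exact .inl isPiNum_card_piCore
    · exact .inr isPiNum_card_piCore
  rcases hps C _ (q.subgroupMap C) (q.subgroupMap_surjective C) hnt with h | h
  · exact h (key' _ (.inl rfl))
  · exact h (key' _ (.inr rfl))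

/-- Subgroups containing the `p`-core inherit triviality of the `p'`-core. -/
theorem piCore_compl_subgroup_eq_bot (hp : p.Prime) (hps : HasPiSections p X)
    (hop : piCore {p}ᶜ X = ⊥) (R : Subgroup X) (hR : piCore {p} X ≤ R) :
    piCore {p}ᶜ R = ⊥ := by
  set E := piCore {p}ᶜ R
  have hcop : ∀ e ∈ E, (e : X) ∈ piCore {p} X → e = 1 := by
    intro e he heO
    have h1 : orderOf e ∣ Nat.card E := by
      rw [← Subgroup.orderOf_mk e he]
      exact orderOf_dvd_natCard _
    have h2 : orderOf e ∣ Nat.card (piCore {p} X) := by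
      rw [← Subgroup.orderOf_coe, ← Subgroup.orderOf_mk (e : X) heO]
      exact orderOf_dvd_natCard _
    rw [← orderOf_eq_one_iff]
    by_contra hne
    obtain ⟨r, hr, hrd⟩ := Nat.exists_prime_and_dvd hne
    exact isPiNum_card_piCore (π := {p}ᶜ) r hr (hrd.trans h1)
      (isPiNum_card_piCore (π := {p}) r hr (hrd.trans h2))
  rw [eq_bot_iff]
  intro e he
  refine hcop e he (centralizer_piCore_le hp hps hop ?_)
  rw [Subgroup.mem_centralizer_iff]
  intro o ho
  have hE : E.Normal := piCore_normal
  have hcomm : (⟨o, hR ho⟩ : R) * e * (⟨o, hR ho⟩ : R)⁻¹ * e⁻¹ = 1 := by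
    refine hcop _ (E.mul_mem (hE.conj_mem e he _) (E.inv_mem he)) ?_
    have h1 := piCore_normal (π := {p}) (X := X) |>.conj_mem _ (Subgroup.inv_mem _ ho) e
    simpa [mul_assoc] using Subgroup.mul_mem _ ho h1
  have := congrArg Subtype.val (mul_inv_eq_iff_eq_mul.1 (mul_inv_eq_one.1 hcomm))
  simpa using this

end PSolvable

section Extension

variable {A : Type*} [CommGroup A]

theorem transfer_apply_mem_of_invariant {N : Type*} [Group N] [Finite N] (Z : Subgroup N)
    [hZ : Z.Normal] (l : Z →* A)
    (hinv : ∀ (g : N) (z : Z), l ⟨g * z * g⁻¹, hZ.conj_mem z z.2 g⟩ = l z) (z : Z) :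
    l.transfer (z : N) = l z ^ Z.index := by
  let _ := Z.fintypeQuotientOfFiniteIndex
  rw [MonoidHom.transfer_def l (default : Z.LeftTransversal)]
  unfold Subgroup.leftTransversals.diff
  have hq : ∀ q : N ⧸ Z, (z : N)⁻¹ • q = q := by
    intro q
    induction q using QuotientGroup.induction_on with
    | H g =>
      rw [MulAction.Quotient.smul_coe, smul_eq_mul, QuotientGroup.eq]
      simpa [mul_assoc] using hZ.conj_mem z z.2 g⁻¹
  rw [Finset.prod_congr rfl fun q _ => ?_, Finset.prod_const, Finset.card_univ,
    ← Nat.card_eq_fintype_card, Subgroup.index]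
  rw [← hinv ((default : Z.LeftTransversal).2.leftQuotientEquiv q : N)⁻¹ z]
  congr 2
  rw [Subgroup.smul_apply_eq_smul_apply_inv_smul, hq]
  simp [mul_assoc]

theorem exists_extension_of_coprime_index {N : Type*} [Group N] [Finite N] (Z : Subgroup N)
    [hZ : Z.Normal] (l : Z →* A)
    (hinv : ∀ (g : N) (z : Z), l ⟨g * z * g⁻¹, hZ.conj_mem z z.2 g⟩ = l z)
    {m : ℕ} (hm : ∀ z, l z ^ m = 1) (hcop : Z.index.Coprime m) :
    ∃ L : N →* A, (∀ z : Z, L z = l z) ∧ ∀ n, L n ^ m = 1 := by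
  obtain ⟨k, hk⟩ : ∃ k : ℕ, Z.index * k ≡ 1 [MOD m] := by
    rcases Nat.eq_zero_or_pos m with rfl | hm0
    · rw [Nat.coprime_zero_right] at hcop
      exact ⟨1, by rw [hcop]⟩
    · obtain rfl | hm1 := (Nat.one_le_iff_ne_zero.2 hm0.ne').eq_or_lt
      · exact ⟨1, Nat.modEq_one⟩
      · obtain ⟨k, -, hk⟩ := Nat.exists_mul_mod_eq_one_of_coprime hcop hm1
        exact ⟨k, by rw [Nat.ModEq, hk, Nat.mod_eq_of_lt hm1]⟩
  refine ⟨l.transfer ^ k, fun z => ?_, fun n => ?_⟩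
  · rw [MonoidHom.pow_apply, transfer_apply_mem_of_invariant Z l hinv, ← pow_mul]
    conv_rhs => rw [← pow_one (l z)]
    rw [pow_eq_pow_iff_modEq]
    exact hk.of_dvd (orderOf_dvd_of_pow_eq_one (hm z))
  · rw [MonoidHom.pow_apply, ← pow_mul, mul_comm, pow_mul,
      MonoidHom.transfer_def l (default : Z.LeftTransversal)]
    unfold Subgroup.leftTransversals.diff
    rw [← Finset.prod_pow, Finset.prod_congr rfl fun q _ => hm _]
    simp

variable {G : Type*} [Group G]

theorem exists_extension_of_coprime_relIndex [Finite G] (Z N : Subgroup G) [hZ : Z.Normal] (hZN : Z ≤ N)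
    (l : Z →* A)
    (hinv : ∀ (g : G) (z : Z), l ⟨g * z * g⁻¹, hZ.conj_mem z z.2 g⟩ = l z)
    {m : ℕ} (hm : ∀ z, l z ^ m = 1) (hcop : (Z.relIndex N).Coprime m) :
    ∃ L : N →* A, (∀ z : Z, L ⟨z, hZN z.2⟩ = l z) ∧ ∀ n, L n ^ m = 1 := by
  let e := Subgroup.subgroupOfEquivOfLe hZN
  obtain ⟨L, h1, h2⟩ := exists_extension_of_coprime_index (Z.subgroupOf N)
    (l.comp e.toMonoidHom) (fun g z => hinv g (e z)) (fun z => hm _) hcop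
  refine ⟨L, fun z => ?_, h2⟩
  have := h1 (e.symm z)
  simp only [MonoidHom.comp_apply] at this
  rw [show e.toMonoidHom (e.symm z) = z from e.apply_symm_apply z] at this
  exact this

theorem extension_invariant (Z N : Subgroup G) [hZ : Z.Normal] [hN : N.Normal] (hZN : Z ≤ N)
    (l : Z →* A) (hinv : ∀ (g : G) (z : Z), l ⟨g * z * g⁻¹, hZ.conj_mem z z.2 g⟩ = l z)
    {m : ℕ} (hcop : (Z.relIndex N).Coprime m) (L : N →* A)
    (hL : ∀ z : Z, L ⟨z, hZN z.2⟩ = l z) (hm : ∀ n, L n ^ m = 1) (g : G) (n : N) :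
    L ⟨g * n * g⁻¹, hN.conj_mem n n.2 g⟩ = L n := by
  set n' : N := ⟨g * n * g⁻¹, hN.conj_mem n n.2 g⟩
  have h1 : (L n' / L n) ^ m = 1 := by rw [div_pow, hm, hm, div_one]
  have h2 : (L n' / L n) ^ Z.relIndex N = 1 := by
    have hn : (n : G) ^ Z.relIndex N ∈ Z := Subgroup.pow_index_mem (Z.subgroupOf N) n
    have e1 : L n ^ Z.relIndex N = l ⟨_, hn⟩ := by
      rw [← map_pow, ← hL]
      rfl
    have e2 : L n' ^ Z.relIndex N = l ⟨_, hn⟩ := by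
      rw [← map_pow, ← hinv g, ← hL]
      congr 1
      ext
      simp [n']
    rw [div_pow, e1, e2, div_self']
  have h3 := pow_gcd_eq_one.2 ⟨h2, h1⟩
  rw [hcop.gcd_eq_one, pow_one] at h3
  exact div_eq_one.1 h3

end Extension

section Isotypic

variable {R M : Type*} [Ring R] [AddCommGroup M] [Module R M] {σ σ' : R →+* R}
  [RingHomInvPair σ σ'] [RingHomInvPair σ' σ]

theorem isSimpleModule_map (e : M ≃ₛₗ[σ] M) (S : Submodule R M) [IsSimpleModule R S] :
    IsSimpleModule R (S.map (e : M →ₛₗ[σ] M)) := by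
  rw [isSimpleModule_iff_isAtom] at *
  exact (OrderIso.isAtom_iff (Submodule.orderIsoMapComap e) S).2 ‹_›

theorem map_isotypicComponent_le (e : M ≃ₛₗ[σ] M) (S : Submodule R M) :
    (isotypicComponent R M S).map (e : M →ₛₗ[σ] M) ≤
      isotypicComponent R M (S.map (e : M →ₛₗ[σ] M)) := by
  rw [Submodule.map_le_iff_le_comap]
  refine sSup_le ?_
  rintro m ⟨i⟩
  rw [← Submodule.map_le_iff_le_comap]
  exact le_sSup ⟨((e.submoduleMap m).symm.trans i).trans (e.submoduleMap S)⟩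

theorem map_isotypicComponent (e : M ≃ₛₗ[σ] M) (S : Submodule R M) :
    (isotypicComponent R M S).map (e : M →ₛₗ[σ] M) =
      isotypicComponent R M (S.map (e : M →ₛₗ[σ] M)) := by
  refine le_antisymm (map_isotypicComponent_le e S) ?_
  have h := map_isotypicComponent_le e.symm (S.map (e : M →ₛₗ[σ] M))
  have hS : (S.map (e : M →ₛₗ[σ] M)).map (e.symm : M →ₛₗ[σ'] M) = S := by
    ext x; simp
  rw [hS] at h
  intro y hy
  exact ⟨e.symm y, h ⟨y, hy, rfl⟩, by simp⟩

theorem map_mem_isotypicComponents (e : M ≃ₛₗ[σ] M) {c : Submodule R M}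
    (hc : c ∈ isotypicComponents R M) :
    c.map (e : M →ₛₗ[σ] M) ∈ isotypicComponents R M := by
  obtain ⟨S, hS, rfl⟩ := hc
  exact ⟨_, isSimpleModule_map e S, map_isotypicComponent e S⟩

end Isotypic

/-- A `p`-group acting on a finite set and preserving a weight of total prime to `p` fixes
an element of weight prime to `p`. -/
theorem IsPGroup.exists_fixed_of_not_dvd_sum {p : ℕ} (hp : p.Prime) {P α : Type*} [Group P]
    [MulAction P α] [Fintype α] (hP : IsPGroup p P) (f : α → ℕ)
    (hf : ∀ (x : P) a, f (x • a) = f a) (hs : ¬ p ∣ ∑ a, f a) :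
    ∃ a, (∀ x : P, x • a = a) ∧ ¬ p ∣ f a := by
  classical
  have := Fact.mk hp
  by_contra! h
  apply hs
  rw [← Finset.sum_fiberwise_of_maps_to (g := f) (t := Finset.univ.image f)
    (fun a _ => Finset.mem_image_of_mem f (Finset.mem_univ a))]
  refine Finset.dvd_sum fun b _ => ?_
  rw [Finset.sum_congr rfl (g := fun _ => b) (fun a ha => (Finset.mem_filter.1 ha).2),
    Finset.sum_const, smul_eq_mul]
  by_cases hb : p ∣ b
  · exact hb.mul_left _
  refine Dvd.dvd.mul_right ?_ _
  let A : SubMulAction P α :=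
    { carrier := {a | f a = b}, smul_mem' := fun x a ha => (hf x a).trans ha }
  by_contra hcard
  have hc : Nat.card A = (Finset.univ.filter fun a => f a = b).card := by
    rw [← Fintype.card_subtype, ← Nat.card_eq_fintype_card]; rfl
  obtain ⟨a, ha⟩ := hP.nonempty_fixed_point_of_prime_not_dvd_card A (by rwa [hc])
  exact hb (a.2 ▸ h a (fun x => congrArg Subtype.val (ha x)))

theorem exists_simple_submodule_invariant {p : ℕ} (hp : p.Prime) {R M P : Type*} [Ring R]
    [Algebra ℂ R] [AddCommGroup M] [Module ℂ M] [Module R M] [IsScalarTower ℂ R M]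
    [FiniteDimensional ℂ M] [IsSemisimpleModule R M] [Group P] (hP : IsPGroup p P)
    (τ : P → R ≃+* R) (T : P →* (M ≃ₗ[ℂ] M)) (hT : ∀ x (r : R) m, T x (r • m) = τ x r • T x m)
    (hM : ¬ p ∣ Module.finrank ℂ M) :
    ∃ S : Submodule R M, IsSimpleModule R S ∧ ¬ p ∣ Module.finrank ℂ S ∧
      ∀ x, ∃ e : S ≃ₗ[ℂ] S, ∀ (r : R) s, e (r • s) = τ x r • e s := by
  classical
  have (c : Submodule R M) : FiniteDimensional ℂ c :=
    inferInstanceAs (FiniteDimensional ℂ (c.restrictScalars ℂ))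
  have hnoeth : IsNoetherian R M := isNoetherian_of_tower ℂ inferInstance
  have := Fintype.ofFinite (isotypicComponents R M)
  have (x : P) : RingHomInvPair (τ x : R →+* R) ((τ x).symm : R →+* R) :=
    RingHomInvPair.of_ringEquiv (τ x)
  have (x : P) : RingHomInvPair ((τ x).symm : R →+* R) (τ x : R →+* R) :=
    RingHomInvPair.of_ringEquiv (τ x).symm
  let e (x : P) : LinearEquiv (τ x : R →+* R) (σ' := ((τ x).symm : R →+* R)) M M :=
    { (T x).toAddEquiv with map_smul' := fun r m => hT x r m }
  have he (x : P) (c : Submodule R M) (m : M) :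
      m ∈ c.map (e x : M →ₛₗ[(τ x : R →+* R)] M) ↔ ∃ a ∈ c, T x a = m := Iff.rfl
  let _ : MulAction P (isotypicComponents R M) :=
    { smul := fun x c => ⟨_, map_mem_isotypicComponents (e x) c.2⟩
      one_smul := fun c => by
        refine Subtype.ext (Submodule.ext fun m => (he 1 c m).trans ?_)
        simp
      mul_smul := fun x y c => by
        refine Subtype.ext (Submodule.ext fun m => (he (x * y) c m).trans ?_)
        refine Iff.trans ?_ (he x _ m).symm
        constructor
        · rintro ⟨a, ha, rfl⟩
          exact ⟨T y a, (he y c _).2 ⟨a, ha, rfl⟩, by simp⟩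
        · rintro ⟨b, hb, rfl⟩
          obtain ⟨a, ha, rfl⟩ := (he y c b).1 hb
          exact ⟨a, ha, by simp⟩ }
  have hind : iSupIndep (fun c : isotypicComponents R M => (c : Submodule R M)) :=
    (sSupIndep_iff _).1 (sSupIndep_isotypicComponents R M)
  have htop : ⨆ c : isotypicComponents R M, (c : Submodule R M) = ⊤ := by
    rw [← sSup_eq_iSup', sSup_isotypicComponents]
  have hsum : ∑ c : isotypicComponents R M, Module.finrank ℂ c = Module.finrank ℂ M := by
    rw [← Module.finrank_directSum]
    exact (((hind.linearEquiv htop).restrictScalars ℂ)).finrank_eq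
  obtain ⟨c, hc, hcp⟩ := hP.exists_fixed_of_not_dvd_sum hp
    (fun c : isotypicComponents R M => Module.finrank ℂ c) (fun x c => by
      refine (LinearEquiv.finrank_eq (M := (c : Submodule R M)) (N := (x • c).1) ?_).symm
      exact
        { toFun := fun m => ⟨T x m, (he x c _).2 ⟨m, m.2, rfl⟩⟩
          invFun := (e x |>.submoduleMap (c : Submodule R M)).symm
          left_inv := (e x |>.submoduleMap (c : Submodule R M)).left_inv
          right_inv := (e x |>.submoduleMap (c : Submodule R M)).right_inv
          map_add' := fun a b => Subtype.ext (map_add (T x) _ _)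
          map_smul' := fun a b => Subtype.ext (map_smul (T x) _ _) }) (by rwa [hsum])
  obtain ⟨S, hS, hSc⟩ := c.2
  have hiso : IsIsotypicOfType R c S := by
    rw [hSc]
    exact IsIsotypicOfType.isotypicComponent R M S
  have hfin : Module.Finite R c := inferInstance
  refine ⟨S, hS, fun hdvd => hcp ?_, fun x => ?_⟩
  · obtain ⟨n, ⟨i⟩⟩ := hiso.linearEquiv_fun
    rw [(i.restrictScalars ℂ).finrank_eq, Module.finrank_pi_fintype]
    exact Finset.dvd_sum fun _ _ => hdvd
  · have hle : S.map (e x : M →ₛₗ[(τ x : R →+* R)] M) ≤ c := by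
      have h1 : (c : Submodule R M).map (e x : M →ₛₗ[(τ x : R →+* R)] M) = c :=
        congrArg Subtype.val (hc x)
      rw [← h1]
      refine Submodule.map_mono ?_
      rw [hSc]
      exact S.le_isotypicComponent
    have := isSimpleModule_map (e x) S
    obtain ⟨i⟩ := isIsotypicOfType_submodule_iff.1 hiso _ hle
    let E := ((e x).submoduleMap S).trans i
    refine ⟨{ E.toAddEquiv with map_smul' := fun a b => ?_ }, fun r s => E.map_smulₛₗ r s⟩
    have h2 : (e x).submoduleMap S (a • b) = a • (e x).submoduleMap S b :=
      Subtype.ext (map_smul (T x) _ _)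
    change i ((e x).submoduleMap S (a • b)) = a • i ((e x).submoduleMap S b)
    rw [h2]
    exact (i.restrictScalars ℂ).map_smul a _

theorem IsSchur.exists_asAlgebraHom_eq {D W : Type*} [Group D] [Finite D] [AddCommGroup W]
    [Module ℂ W] [FiniteDimensional ℂ W] {φ : Representation ℂ D W} (h : IsSchur φ)
    (A : Module.End ℂ W) : ∃ r : MonoidAlgebra ℂ D, φ.asAlgebraHom r = A := by
  have := h.isSimpleModule
  have hfin : Module.Finite ℂ φ.asModule := inferInstanceAs (Module.Finite ℂ W)
  obtain ⟨s, hs⟩ := hfin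
  let f : Module.End (Module.End (MonoidAlgebra ℂ D) φ.asModule) φ.asModule :=
    { toFun := fun m => φ.asModuleEquiv.symm (A (φ.asModuleEquiv m))
      map_add' := by simp
      map_smul' := fun B m => by
        obtain ⟨c, hc⟩ := h.2 (φ.asModuleEquiv.conj (B.restrictScalars ℂ)) (fun g => by
          ext w
          have h1 := B.map_smul (MonoidAlgebra.of ℂ D g) (φ.asModuleEquiv.symm w)
          have h2 := congrArg φ.asModuleEquiv h1
          rw [Representation.asModuleEquiv_map_smul, Representation.asAlgebraHom_of] at h2
          simpa using h2)
        have hB (m) : φ.asModuleEquiv (B m) = c • φ.asModuleEquiv m := by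
          have h1 := LinearMap.congr_fun hc (φ.asModuleEquiv m)
          simpa using h1
        apply φ.asModuleEquiv.injective
        simp [hB] }
  obtain ⟨r, hr⟩ := jacobson_density f s
  refine ⟨r, ?_⟩
  have h1 : φ.asModuleEquiv.conj.symm (φ.asAlgebraHom r) = φ.asModuleEquiv.conj.symm A := by
    refine LinearMap.ext_on hs fun m hm => ?_
    have h2 := hr m hm
    apply φ.asModuleEquiv.injective
    have h3 := congrArg φ.asModuleEquiv h2
    simp only [f, LinearMap.coe_mk, AddHom.coe_mk, LinearEquiv.apply_symm_apply,
      Representation.asModuleEquiv_map_smul] at h3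
    exact h3.symm
  exact φ.asModuleEquiv.conj.symm.injective h1

theorem IsSchur.finrank_sq_le_index {D W : Type*} [Group D] [Finite D] [AddCommGroup W]
    [Module ℂ W] [FiniteDimensional ℂ W] {φ : Representation ℂ D W} (h : IsSchur φ)
    (N : Subgroup D) (l : N → ℂ) (hl : ∀ n : N, φ n = l n • 1) :
    Module.finrank ℂ W ^ 2 ≤ N.index := by
  have := Fintype.ofFinite (D ⧸ N)
  have htop : Submodule.span ℂ (Set.range fun q : D ⧸ N => φ q.out) = ⊤ := by
    rw [eq_top_iff]
    rintro A -
    obtain ⟨r, rfl⟩ := h.exists_asAlgebraHom_eq A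
    rw [Representation.asAlgebraHom_def, MonoidAlgebra.lift_apply]
    refine Submodule.sum_mem _ fun d _ => Submodule.smul_mem _ _ ?_
    obtain ⟨n, hn⟩ := QuotientGroup.mk_out_eq_mul N d
    have : φ d = (l n⁻¹) • φ (d : D ⧸ N).out := by
      have h1 : φ d = φ (d : D ⧸ N).out * φ (n⁻¹ : N) := by
        rw [← map_mul, hn]; simp
      rw [h1, hl, mul_smul_comm, mul_one]
    rw [this]
    exact Submodule.smul_mem _ _ (Submodule.subset_span ⟨_, rfl⟩)
  have h1 := finrank_range_le_card (R := ℂ) fun q : D ⧸ N => φ q.out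
  rw [Set.finrank, htop, finrank_top, Module.finrank_linearMap] at h1
  rw [sq, Subgroup.index, Nat.card_eq_fintype_card]
  exact h1

theorem exists_invariant_isSchur_of_equivariant {p : ℕ} (hp : p.Prime) {D P V : Type*} [Group D]
    [Finite D] [Group P] (hP : IsPGroup p P) [AddCommGroup V] [Module ℂ V] [FiniteDimensional ℂ V]
    (ρ : Representation ℂ D V) (α : P →* MulAut D) (T : P →* (V ≃ₗ[ℂ] V))
    (hT : ∀ x d v, T x (ρ d v) = ρ (α x d) (T x v)) (hV : ¬ p ∣ Module.finrank ℂ V) :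
    ∃ (S : Submodule ℂ V) (φ : Representation ℂ D S), IsSchur φ ∧
      (∀ d s, (φ d s : V) = ρ d s) ∧ ¬ p ∣ Module.finrank ℂ S ∧
      ∀ x, ∃ A : Module.End ℂ S, IsUnit A ∧ ∀ d, A * φ d = φ (α x d) * A := by
  let _ : Module (MonoidAlgebra ℂ D) V := Module.compHom V ρ.asAlgebraHom.toRingHom
  have hsmul (r : MonoidAlgebra ℂ D) (v : V) : r • v = ρ.asAlgebraHom r v := rfl
  have hof (d : D) (v : V) : MonoidAlgebra.of ℂ D d • v = ρ d v := by
    rw [hsmul, Representation.asAlgebraHom_of]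
  have : IsScalarTower ℂ (MonoidAlgebra ℂ D) V :=
    ⟨fun c r v => by rw [hsmul, map_smul, hsmul]; rfl⟩
  have hT' (x : P) (r : MonoidAlgebra ℂ D) (v : V) :
      T x (r • v) = MonoidAlgebra.mapDomainRingEquiv ℂ (α x) r • T x v := by
    induction r using MonoidAlgebra.induction_on with
    | of g =>
      rw [hof, hT, ← hof]
      congr 1
      simp
    | add a b ha hb => rw [add_smul, map_add, map_add, ha, hb, add_smul]
    | smul c r hr =>
      have : MonoidAlgebra.mapDomainRingEquiv ℂ (α x) (c • r) =
        c • MonoidAlgebra.mapDomainRingEquiv ℂ (α x) r :=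
        (MonoidAlgebra.domCongr ℂ ℂ (α x)).toLinearEquiv.map_smul c r
      rw [this, smul_assoc, map_smul, hr, smul_assoc]
  obtain ⟨S, hS, hSp, hSe⟩ := exists_simple_submodule_invariant hp hP
    (fun x => MonoidAlgebra.mapDomainRingEquiv ℂ (α x)) T hT' hV
  have hSfd : FiniteDimensional ℂ S :=
    inferInstanceAs (FiniteDimensional ℂ (S.restrictScalars ℂ))
  let φ : Representation ℂ D (S.restrictScalars ℂ) :=
    { toFun := fun d => (ρ d).restrict fun v hv => by
        rw [← hof]
        exact S.smul_mem _ hv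
      map_one' := by ext; simp
      map_mul' := fun a b => by ext; simp }
  have hφ (d : D) (s : S) : φ d s = MonoidAlgebra.of ℂ D d • s :=
    Subtype.ext (hof d s).symm
  refine ⟨S.restrictScalars ℂ, φ, ⟨?_, fun A hA => ?_⟩, fun d s => rfl, hSp, fun x => ?_⟩
  · exact IsSimpleModule.nontrivial (MonoidAlgebra ℂ D) S
  · have hlin (r : MonoidAlgebra ℂ D) (s : S) : A (r • s) = r • (A s : S) := by
      induction r using MonoidAlgebra.induction_on with
      | of g =>
        refine (congrArg A (hφ g s)).symm.trans ?_
        exact (LinearMap.congr_fun (hA g) s).trans (hφ g _)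
      | add a b ha hb =>
        rw [add_smul, add_smul, ← ha, ← hb]; exact A.map_add _ _
      | smul c r hr =>
        rw [smul_assoc, smul_assoc, ← hr]; exact A.map_smul c _
    let B : Module.End (MonoidAlgebra ℂ D) S :=
      { toFun := A, map_add' := A.map_add, map_smul' := hlin }
    obtain ⟨c, hc⟩ := (IsSimpleModule.algebraMap_end_bijective_of_isAlgClosed ℂ).2 B
    exact ⟨c, LinearMap.ext fun s => (LinearMap.congr_fun hc s).symm⟩
  · obtain ⟨e, he⟩ := hSe x
    refine ⟨(e : S →ₗ[ℂ] S), (Module.End.isUnit_iff _).2 e.bijective, fun d => ?_⟩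
    refine LinearMap.ext fun s => ?_
    refine (congrArg e (hφ d s)).trans ((he _ _).trans ?_)
    refine Eq.trans ?_ (hφ (α x d) (e s)).symm
    congr 1
    simp

theorem exists_invariant_isSchur {p : ℕ} (hp : p.Prime) {D P : Type} [Group D] [Finite D]
    [Group P] (hP : IsPGroup p P) (N : Subgroup D) [hN : N.Normal] (l : N →* ℂˣ)
    (hl : ∀ d (n : N), l ⟨d * n * d⁻¹, hN.conj_mem n n.2 d⟩ = l n)
    (α : P →* MulAut D) (hα : ∀ x (n : N), ∃ h : α x n ∈ N, l ⟨α x n, h⟩ = l n)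
    (hidx : ¬ p ∣ N.index) :
    ∃ (W : Type) (_ : AddCommGroup W) (_ : Module ℂ W) (_ : FiniteDimensional ℂ W)
      (φ : Representation ℂ D W), IsSchur φ ∧ (∀ n : N, φ n = (l n : ℂ) • 1) ∧
      ¬ p ∣ Module.finrank ℂ W ∧ Module.finrank ℂ W ^ 2 ≤ N.index ∧
      ∀ x, ∃ A : Module.End ℂ W, IsUnit A ∧ ∀ d, A * φ d = φ (α x d) * A := by
  let Y : Representation ℂ N ℂ :=
    { toFun := fun n => (l n : ℂ) • 1
      map_one' := by simp
      map_mul' := fun a b => by ext; simp [mul_comm] }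
  have hY (F : Representation.coindV N.subtype Y) (n : N) (h : D) :
      F.1 (n * h) = l n * F.1 h := F.2 n h
  let t (x : P) : Representation.coindV N.subtype Y →ₗ[ℂ] Representation.coindV N.subtype Y :=
    { toFun := fun F => ⟨fun h => F.1 (α x⁻¹ h), fun n h => by
        obtain ⟨h1, h2⟩ := hα x⁻¹ n
        have := hY F ⟨_, h1⟩ (α x⁻¹ h)
        rw [h2] at this
        simpa [Y] using this⟩
      map_add' := fun F F' => rfl
      map_smul' := fun c F => rfl }
  have ht (x y : P) : t (x * y) = t x ∘ₗ t y := by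
    ext F h
    change F.1 (α (x * y)⁻¹ h) = F.1 (α y⁻¹ (α x⁻¹ h))
    simp
  have ht1 : t 1 = LinearMap.id := by
    ext F h
    change F.1 (α 1⁻¹ h) = F.1 h
    simp
  let E (x : P) : Representation.coindV N.subtype Y ≃ₗ[ℂ] Representation.coindV N.subtype Y :=
    LinearEquiv.ofLinearMap (t x) (t x⁻¹) (by rw [← ht, mul_inv_cancel, ht1])
      (by rw [← ht, inv_mul_cancel, ht1])
  let T : P →* (Representation.coindV N.subtype Y ≃ₗ[ℂ] Representation.coindV N.subtype Y) :=
    { toFun := E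
      map_one' := LinearEquiv.ext fun v => LinearMap.congr_fun ht1 v
      map_mul' := fun x y => LinearEquiv.ext fun v => LinearMap.congr_fun (ht x y) v }
  obtain ⟨S, φ, hφ, hφρ, hSp, hSe⟩ := exists_invariant_isSchur_of_equivariant hp hP
    (Representation.coind N.subtype Y) α T (fun x d F => by
      ext h
      change F.1 (α x⁻¹ h * d) = F.1 (α x⁻¹ (h * α x d))
      simp) (by rwa [finrank_coindV N Y, Module.finrank_self, mul_one])
  have hφN (n : N) : φ n = (l n : ℂ) • 1 := by
    ext s h
    rw [hφρ]
    change (s : Representation.coindV N.subtype Y).1 (h * n) = l n * s.1.1 h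
    rw [← hl h n, ← hY]
    simp
  exact ⟨S, inferInstance, inferInstance, inferInstance, φ, hφ, hφN, hSp,
    hφ.finrank_sq_le_index N _ hφN, hSe⟩

open scoped TensorProduct

theorem IsSchur.smul_apply_injective {Z W : Type*} [Group Z] [AddCommGroup W] [Module ℂ W]
    {lam : Representation ℂ Z W} (hlam : IsSchur lam) (z : Z) {c c' : ℂˣ}
    (h : (c : ℂ) • lam z = (c' : ℂ) • lam z) : c = c' := by
  have := hlam.1
  have h1 := congrArg (· * lam z⁻¹) h
  simp only [smul_mul_assoc, ← map_mul, mul_inv_cancel, map_one] at h1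
  exact Units.ext (smul_left_injective ℂ one_ne_zero h1)

theorem TensorProduct.map_id_injective {W X : Type*} [AddCommGroup W] [Module ℂ W] [Nontrivial W]
    [AddCommGroup X] [Module ℂ X] {A B : Module.End ℂ X}
    (h : TensorProduct.map (LinearMap.id : W →ₗ[ℂ] W) A = TensorProduct.map LinearMap.id B) :
    A = B := by
  obtain ⟨w, hw⟩ := exists_ne (0 : W)
  obtain ⟨f, hf⟩ : ∃ f : Module.Dual ℂ W, f w ≠ 0 := by
    by_contra! hf
    exact hw ((Module.forall_dual_apply_eq_zero_iff ℂ w).1 hf)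
  ext x
  have h1 := congrArg (fun v => TensorProduct.lid ℂ X (f.rTensor X v))
    (LinearMap.congr_fun h (w ⊗ₜ x))
  simpa [hf] using h1

section Cover

variable {G W : Type} [Group G] (Z : Subgroup G) [hZ : Z.Normal] [AddCommGroup W] [Module ℂ W]
  (lam : Representation ℂ Z W) (o : ℕ)

/-- The pairs `(g, A)` such that `A` intertwines `lam` with its conjugate by `g` and `det A` is
an `o`-th root of unity. -/
def intertwinerCover : Subgroup (G × (Module.End ℂ W)ˣ) where
  carrier := {γ | (∀ z : Z, (γ.2 : Module.End ℂ W) * lam z =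
    lam ⟨γ.1 * z * γ.1⁻¹, hZ.conj_mem z z.2 γ.1⟩ * γ.2) ∧
      LinearMap.det (γ.2 : Module.End ℂ W) ^ o = 1}
  one_mem' := by simp
  mul_mem' := by
    rintro ⟨a, A⟩ ⟨b, B⟩ ⟨ha, hA⟩ ⟨hb, hB⟩
    refine ⟨fun z => ?_, by simp_all [mul_pow]⟩
    have h1 := ha ⟨b * z * b⁻¹, hZ.conj_mem z z.2 b⟩
    have h2 := hb z
    simp only [Prod.mk_mul_mk, Units.val_mul] at h1 h2 ⊢
    rw [mul_assoc, h2, ← mul_assoc, h1, mul_assoc]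
    simp only [mul_assoc, mul_inv_rev]
  inv_mem' := by
    rintro ⟨a, A⟩ ⟨ha, hA⟩
    refine ⟨fun z => ?_, ?_⟩
    · have h1 := ha ⟨a⁻¹ * z * a, by simpa using hZ.conj_mem z z.2 a⁻¹⟩
      simp only [Prod.fst_inv, Prod.snd_inv, inv_inv] at h1 ⊢
      rw [Units.inv_mul_eq_iff_eq_mul, ← mul_assoc, h1, Units.mul_inv_cancel_right]
      congr 2
      simp [mul_assoc]
    · have h1 : LinearMap.det (A : Module.End ℂ W) * 
          LinearMap.det ((A⁻¹ : (Module.End ℂ W)ˣ) : Module.End ℂ W) = 1 := by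
        rw [← map_mul, Units.mul_inv, map_one]
      have h2 := congrArg (· ^ o) h1
      simp only [mul_pow, one_pow] at h2
      change LinearMap.det (A : Module.End ℂ W) ^ o = 1 at hA
      rw [hA, one_mul] at h2
      exact h2

variable {Z lam o}

theorem intertwinerCover.exists_smul (hlam : IsSchur lam) {γ : G × (Module.End ℂ W)ˣ}
    (hγ : γ ∈ intertwinerCover Z lam o) (h : γ.1 ∈ Z) :
    ∃ c : ℂˣ, (γ.2 : Module.End ℂ W) = (c : ℂ) • lam ⟨γ.1, h⟩ := by
  have hcomm : ∀ z : Z, (lam (⟨γ.1, h⟩⁻¹ : Z) * γ.2) * lam z =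
      lam z * (lam (⟨γ.1, h⟩⁻¹ : Z) * γ.2) := by
    intro z
    rw [mul_assoc, hγ.1 z, ← mul_assoc, ← map_mul, ← mul_assoc, ← map_mul]
    congr 2
    ext
    simp [mul_assoc]
  obtain ⟨c, hc⟩ := hlam.2 _ hcomm
  have h1 : (γ.2 : Module.End ℂ W) = c • lam ⟨γ.1, h⟩ := by
    have := congrArg (lam ⟨γ.1, h⟩ * ·) hc
    simpa [← mul_assoc, ← map_mul] using this
  have hc0 : c ≠ 0 := by
    rintro rfl
    have := hlam.1
    rw [zero_smul] at h1
    exact γ.2.ne_zero h1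
  exact ⟨Units.mk0 c hc0, h1⟩

theorem pow_eq_one_of_mem_intertwinerCover [FiniteDimensional ℂ W]
    (ho : ∀ z, LinearMap.det (lam z) ^ o = 1) {γ : G × (Module.End ℂ W)ˣ}
    (hγ : γ ∈ intertwinerCover Z lam o) (h : γ.1 ∈ Z) {c : ℂˣ}
    (hc : (γ.2 : Module.End ℂ W) = (c : ℂ) • lam ⟨γ.1, h⟩) :
    c ^ (o * Module.finrank ℂ W) = 1 := by
  have h1 := hγ.2
  rw [hc, LinearMap.det_smul, mul_pow, ho, mul_one, ← pow_mul, mul_comm] at h1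
  exact Units.ext (by simpa using h1)

theorem intertwinerCover.fst_surjective [FiniteDimensional ℂ W]
    (hlam : IsSchur lam) (hinv : ∀ g, ∃ A : Module.End ℂ W, IsUnit A ∧
      ∀ z : Z, A * lam z = lam ⟨g * z * g⁻¹, hZ.conj_mem z z.2 g⟩ * A) (g : G) :
    ∃ γ ∈ intertwinerCover Z lam o, γ.1 = g := by
  have := hlam.1
  obtain ⟨A, hA, hAz⟩ := hinv g
  have hdet : LinearMap.det A ≠ 0 := ((LinearMap.isUnit_iff_isUnit_det A).1 hA).ne_zero
  obtain ⟨c, hc⟩ := IsAlgClosed.exists_pow_nat_eq (LinearMap.det A)⁻¹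
    (Module.finrank_pos (R := ℂ) (M := W))
  have hB : LinearMap.det (c • A) = 1 := by
    rw [LinearMap.det_smul, hc, inv_mul_cancel₀ hdet]
  have hBu : IsUnit (c • A) := (LinearMap.isUnit_iff_isUnit_det _).2 (by rw [hB]; exact isUnit_one)
  refine ⟨(g, hBu.unit), ⟨fun z => ?_, ?_⟩, rfl⟩
  · simp only [IsUnit.unit_spec, smul_mul_assoc, hAz, mul_smul_comm]
  · simp only [IsUnit.unit_spec, hB, one_pow]

theorem intertwinerCover.finite [Finite G] [FiniteDimensional ℂ W] (hlam : IsSchur lam)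
    (ho : ∀ z, LinearMap.det (lam z) ^ o = 1) (ho0 : o ≠ 0) :
    Finite (intertwinerCover Z lam o) := by
  have := hlam.1
  let q : intertwinerCover Z lam o →* G := (MonoidHom.fst _ _).comp (Subgroup.subtype _)
  have h1 : Finite (intertwinerCover Z lam o ⧸ q.ker) :=
    Finite.of_equiv _ (QuotientGroup.quotientKerEquivRange q).symm.toEquiv
  have : NeZero (o * Module.finrank ℂ W) :=
    ⟨mul_ne_zero ho0 (Module.finrank_pos (R := ℂ) (M := W)).ne'⟩
  have h2 (x : q.ker) : ∃ c : rootsOfUnity (o * Module.finrank ℂ W) ℂ,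
      (x.1.1.2 : Module.End ℂ W) = ((c : ℂˣ) : ℂ) • 1 := by
    have hx : x.1.1.1 = 1 := x.2
    have hx' : x.1.1.1 ∈ Z := hx ▸ Z.one_mem
    obtain ⟨c, hc⟩ := intertwinerCover.exists_smul hlam x.1.2 hx'
    refine ⟨⟨c, pow_eq_one_of_mem_intertwinerCover ho x.1.2 hx' hc⟩, hc.trans ?_⟩
    rw [show (⟨x.1.1.1, hx'⟩ : Z) = 1 from Subtype.ext hx, map_one]
  choose c hc using h2
  have h3 : Finite q.ker := Finite.of_injective c fun x y hxy => by
    refine Subtype.ext (Subtype.ext (Prod.ext ?_ (Units.ext ?_)))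
    · exact (show x.1.1.1 = 1 from x.2).trans (show y.1.1.1 = 1 from y.2).symm
    · rw [hc, hc, hxy]
  exact Finite.of_subgroup_quotient q.ker

/-- The linear character of the preimage of `Z` in the cover recording the inverse of the scalar
by which the second component differs from `lam`. -/
theorem exists_cover_character [FiniteDimensional ℂ W] (hlam : IsSchur lam)
    (ho : ∀ z, LinearMap.det (lam z) ^ o = 1) (K : Subgroup (intertwinerCover Z lam o))
    (hK : ∀ γ : intertwinerCover Z lam o, γ ∈ K ↔ γ.1.1 ∈ Z) :
    ∃ ε : K →* ℂˣ, (∀ γ : K, (γ.1.1.2 : Module.End ℂ W) =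
      ((ε γ)⁻¹ : ℂˣ).1 • lam ⟨γ.1.1.1, (hK γ).1 γ.2⟩) ∧
      (∀ γ, ε γ ^ (o * Module.finrank ℂ W) = 1) ∧
      ∀ (γ : intertwinerCover Z lam o) (κ : K) (h : γ * κ * γ⁻¹ ∈ K),
        ε ⟨γ * κ * γ⁻¹, h⟩ = ε κ := by
  choose c hc using fun γ : K => intertwinerCover.exists_smul hlam γ.1.2 ((hK γ).1 γ.2)
  have hmul (a b : K) : c (a * b) = c a * c b := by
    apply hlam.smul_apply_injective ⟨(a * b).1.1.1, (hK _).1 (a * b).2⟩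
    rw [← hc]
    have : lam ⟨(a * b).1.1.1, (hK _).1 (a * b).2⟩ =
      lam ⟨a.1.1.1, (hK _).1 a.2⟩ * lam ⟨b.1.1.1, (hK _).1 b.2⟩ := by
      rw [← map_mul]; rfl
    rw [this, Units.val_mul, mul_smul, ← mul_smul_comm, ← smul_mul_assoc, ← hc, ← hc]
    rfl
  let c' : K →* ℂˣ := MonoidHom.mk' c hmul
  refine ⟨c'⁻¹, fun γ => ?_, fun γ => ?_, fun γ κ h => ?_⟩
  · simpa [c'] using hc γ
  · have := pow_eq_one_of_mem_intertwinerCover ho γ.1.2 ((hK γ).1 γ.2) (hc γ)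
    simpa [c'] using this
  · simp only [MonoidHom.inv_apply, inv_inj]
    change c _ = c _
    apply hlam.smul_apply_injective ⟨(γ * κ * γ⁻¹).1.1, (hK _).1 h⟩
    have h1 := γ.2.1 ⟨κ.1.1.1, (hK κ).1 κ.2⟩
    have h2 : (γ * κ * γ⁻¹).1.2 = γ.1.2 * κ.1.1.2 * γ.1.2⁻¹ := rfl
    rw [← hc ⟨γ * κ * γ⁻¹, h⟩]
    change ((γ * κ * γ⁻¹).1.2 : Module.End ℂ W) = _
    rw [h2, Units.val_mul, Units.val_mul, hc κ, mul_smul_comm, smul_mul_assoc, h1,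
      Units.mul_inv_cancel_right]
    rfl

end Cover

/-- The theorem for triples `(G, ker π, l)` with `l` linear and quotient of order `n`. -/
def LinearTripleClaim (p n : ℕ) : Prop :=
  ∀ (G X : Type) [Group G] [Finite G] [Group X] [Finite X] (π : G →* X),
    Function.Surjective π → Nat.card X = n → ∀ l : π.ker →* ℂˣ,
    (∀ g (z : π.ker), l ⟨g * z * g⁻¹, π.normal_ker.conj_mem z z.2 g⟩ = l z) →
    ∀ m, ¬ p ∣ m → (∀ z, l z ^ m = 1) → HasPiSections p X → piCore {p}ᶜ X = ⊥ → ∀ d : ℕ,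
    (∀ (V : Type) [AddCommGroup V] [Module ℂ V] [FiniteDimensional ℂ V]
      (ρ : Representation ℂ G V), IsSchur ρ → (∀ z : π.ker, ρ z = (l z : ℂ) • 1) →
      ¬ p ∣ Module.finrank ℂ V → Module.finrank ℂ V = d) → IsPGroup p X

theorem exists_tensor_descent {G W X : Type} [Group G] (Z : Subgroup G) [hZ : Z.Normal]
    [AddCommGroup W] [Module ℂ W] [FiniteDimensional ℂ W] [AddCommGroup X] [Module ℂ X]
    [FiniteDimensional ℂ X]
    {lam : Representation ℂ Z W} {o : ℕ} (hlam : IsSchur lam)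
    (hsurj : ∀ g, ∃ γ ∈ intertwinerCover Z lam o, γ.1 = g)
    (τ : Representation ℂ (intertwinerCover Z lam o) X) (hτ : IsSchur τ)
    (hτZ : ∀ (γ : intertwinerCover Z lam o) (h : γ.1.1 ∈ Z), ∃ c : ℂˣ,
      (γ.1.2 : Module.End ℂ W) = ((c⁻¹ : ℂˣ) : ℂ) • lam ⟨γ.1.1, h⟩ ∧ τ γ = (c : ℂ) • 1) :
    ∃ ρ : Representation ℂ G (W ⊗[ℂ] X), IsSchur ρ ∧
      ∀ z : Z, ρ z = TensorProduct.map (lam z) LinearMap.id := by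
  let q : intertwinerCover Z lam o →* G := (MonoidHom.fst _ _).comp (Subgroup.subtype _)
  have hq : Function.Surjective q := fun g => by
    obtain ⟨γ, hγ, h⟩ := hsurj g
    exact ⟨⟨γ, hγ⟩, h⟩
  let Θ : intertwinerCover Z lam o →* Module.End ℂ (W ⊗[ℂ] X) :=
    { toFun := fun γ => TensorProduct.map (γ.1.2 : Module.End ℂ W) (τ γ)
      map_one' := by
        rw [map_one]; exact TensorProduct.map_id
      map_mul' := fun a b => by
        rw [map_mul]; exact TensorProduct.map_comp _ _ _ _ }
  have hΘZ (γ : intertwinerCover Z lam o) (h : γ.1.1 ∈ Z) :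
      Θ γ = TensorProduct.map (lam ⟨γ.1.1, h⟩) LinearMap.id := by
    obtain ⟨c, h1, h2⟩ := hτZ γ h
    change TensorProduct.map (γ.1.2 : Module.End ℂ W) (τ γ) = _
    rw [h1, h2, TensorProduct.map_smul_left, TensorProduct.map_smul_right, smul_smul]
    simp
    rfl
  have hker : q.ker ≤ Θ.toHomUnits.ker := fun γ hγ => by
    have h1 : γ.1.1 = 1 := hγ
    have h2 : γ.1.1 ∈ Z := h1 ▸ Z.one_mem
    refine Units.ext ((hΘZ γ h2).trans ?_)
    rw [show (⟨γ.1.1, h2⟩ : Z) = 1 from Subtype.ext h1, map_one]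
    exact TensorProduct.map_id
  let ρ' := q.liftOfRightInverse _ (Function.rightInverse_surjInv hq) ⟨_, hker⟩
  have hρ' (γ) : (ρ' (q γ) : Module.End ℂ (W ⊗[ℂ] X)) = Θ γ := by
    have := q.liftOfRightInverse_comp_apply _ (Function.rightInverse_surjInv hq) ⟨_, hker⟩ γ
    exact congrArg Units.val this
  let ρ : Representation ℂ G (W ⊗[ℂ] X) := (Units.coeHom _).comp ρ'
  have hρ (γ) : ρ (q γ) = Θ γ := hρ' γ
  have hρZ (z : Z) : ρ z = TensorProduct.map (lam z) LinearMap.id := by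
    obtain ⟨γ, hγ⟩ := hq z
    rw [← hγ, hρ, hΘZ γ (by change q γ ∈ Z; rw [hγ]; exact z.2)]
    congr 2
    exact Subtype.ext hγ
  have hW := hlam.1
  have hX := hτ.1
  refine ⟨ρ, ⟨?_, fun Φ hΦ => ?_⟩, hρZ⟩
  · have := Module.finrank_pos (R := ℂ) (M := W)
    have := Module.finrank_pos (R := ℂ) (M := X)
    exact Module.nontrivial_of_finrank_pos (R := ℂ) (by rw [Module.finrank_tensorProduct]; positivity)
  · obtain ⟨Ψ, rfl⟩ := hlam.exists_eq_map_id (Φ := Φ) fun z => by rw [← hρZ]; exact hΦ z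
    obtain ⟨c, rfl⟩ := hτ.2 Ψ fun γ => by
      have h1 := hΦ (q γ)
      rw [hρ] at h1
      apply TensorProduct.map_id_injective (W := W)
      have h2 := congrArg (TensorProduct.map ((γ.1.2⁻¹ : (Module.End ℂ W)ˣ) : Module.End ℂ W)
        (LinearMap.id : X →ₗ[ℂ] X) * ·) h1
      change TensorProduct.map _ _ ∘ₗ (TensorProduct.map _ _ ∘ₗ TensorProduct.map _ _) =
        TensorProduct.map _ _ ∘ₗ (TensorProduct.map _ _ ∘ₗ TensorProduct.map _ _) at h2
      simp only [← TensorProduct.map_comp, LinearMap.id_comp, LinearMap.comp_id] at h2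
      rw [show ((γ.1.2⁻¹ : (Module.End ℂ W)ˣ) : Module.End ℂ W) ∘ₗ (γ.1.2 : Module.End ℂ W) =
        LinearMap.id from γ.1.2.inv_mul] at h2
      exact h2
    refine ⟨c, ?_⟩
    rw [TensorProduct.map_smul_right]
    congr 1
    exact TensorProduct.map_id

theorem IsSchur.of_finrank_eq_one {G V : Type*} [Group G] [AddCommGroup V] [Module ℂ V]
    (ρ : Representation ℂ G V) (h : Module.finrank ℂ V = 1) : IsSchur ρ := by
  have : FiniteDimensional ℂ V := .of_finrank_pos (by omega)
  refine ⟨Module.nontrivial_of_finrank_pos (R := ℂ) (by omega), fun A _ => ?_⟩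
  obtain ⟨v, hv, hspan⟩ := finrank_eq_one_iff'.1 h
  obtain ⟨c, hc⟩ := hspan (A v)
  refine ⟨c, LinearMap.ext fun w => ?_⟩
  obtain ⟨a, rfl⟩ := hspan w
  rw [map_smul, ← hc, LinearMap.smul_apply, Module.End.one_apply, smul_comm]

theorem LinearTripleClaim.isPGroup {p : ℕ} (hp : p.Prime) {G X W : Type} [Group G] [Finite G]
    [Group X] [Finite X] (hC : LinearTripleClaim p (Nat.card X)) (π : G →* X)
    (hπ : Function.Surjective π) [AddCommGroup W] [Module ℂ W] [FiniteDimensional ℂ W]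
    (lam : Representation ℂ π.ker W) (hlam : IsSchur lam)
    (hinv : ∀ g, ∃ A : Module.End ℂ W, IsUnit A ∧ ∀ z : π.ker,
      A * lam z = lam ⟨g * z * g⁻¹, π.normal_ker.conj_mem z z.2 g⟩ * A)
    (o : ℕ) (ho : ∀ z, LinearMap.det (lam z) ^ o = 1) (hpo : ¬ p ∣ o * Module.finrank ℂ W)
    (hps : HasPiSections p X) (hop : piCore {p}ᶜ X = ⊥) (e : ℕ)
    (he : ∀ (Y : Type) [AddCommGroup Y] [Module ℂ Y] [FiniteDimensional ℂ Y]
      (ρ : Representation ℂ G (W ⊗[ℂ] Y)), IsSchur ρ →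
      (∀ z : π.ker, ρ z = TensorProduct.map (lam z) LinearMap.id) →
      ¬ p ∣ Module.finrank ℂ Y → Module.finrank ℂ Y = e) :
    IsPGroup p X ∧ e = 1 := by
  have hW := hlam.1
  have ho0 : o ≠ 0 := by rintro rfl; simp at hpo
  have := intertwinerCover.finite hlam ho ho0
  have hsurj := intertwinerCover.fst_surjective (o := o) hlam hinv
  let q : intertwinerCover π.ker lam o →* G := (MonoidHom.fst _ _).comp (Subgroup.subtype _)
  have hq : Function.Surjective q := fun g => by
    obtain ⟨γ, hγ, h⟩ := hsurj g
    exact ⟨⟨γ, hγ⟩, h⟩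
  obtain ⟨ε, hε, hεo, hεinv⟩ := exists_cover_character hlam ho (π.comp q).ker (fun γ => Iff.rfl)
  have hdesc (Y : Type) [AddCommGroup Y] [Module ℂ Y] [FiniteDimensional ℂ Y]
      (τ : Representation ℂ (intertwinerCover π.ker lam o) Y) (hτ : IsSchur τ)
      (hτε : ∀ z : (π.comp q).ker, τ z = (ε z : ℂ) • 1) (hY : ¬ p ∣ Module.finrank ℂ Y) :
      Module.finrank ℂ Y = e := by
    obtain ⟨ρ, hρ, hρZ⟩ := exists_tensor_descent π.ker hlam hsurj τ hτ
      (fun γ h => ⟨ε ⟨γ, h⟩, hε ⟨γ, h⟩, hτε ⟨γ, h⟩⟩)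
    exact he Y ρ hρ hρZ hY
  have hX : IsPGroup p X := hC _ X (π.comp q) (hπ.comp hq) rfl ε
    (fun γ κ => hεinv γ κ _) _ hpo hεo hps hop e hdesc
  refine ⟨hX, ?_⟩
  have hs : Function.Surjective (π.comp q) := hπ.comp hq
  obtain ⟨L, hL, -⟩ := exists_extension_of_coprime_index (π.comp q).ker ε
    (fun γ κ => hεinv γ κ _) hεo (by
      rw [Subgroup.index_ker, MonoidHom.range_eq_top.2 hs, Subgroup.card_top]
      have := Fact.mk hp
      obtain ⟨k, hk⟩ := IsPGroup.iff_card.1 hX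
      rw [hk]
      exact ((hp.coprime_iff_not_dvd).2 hpo).pow_left k)
  let τ : Representation ℂ (intertwinerCover π.ker lam o) ℂ :=
    { toFun := fun n => (L n : ℂ) • 1
      map_one' := by simp
      map_mul' := fun a b => by ext; simp [mul_comm] }
  have h1 := hdesc ℂ τ (.of_finrank_eq_one τ (Module.finrank_self ℂ))
    (fun z => by rw [← hL]; rfl) (by rw [Module.finrank_self]; exact hp.one_lt.not_ge ∘ Nat.le_of_dvd one_pos)
  rw [← h1, Module.finrank_self]

theorem IsPGroup.exists_hom_zmod_of_ne_top {p : ℕ} (hp : p.Prime) {Q : Type*} [Group Q] [Finite Q]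
    (hQ : IsPGroup p Q) {C : Subgroup Q} (hC : C ≠ ⊤) :
    ∃ f : Q →* Multiplicative (ZMod p), C ≤ f.ker ∧ f ≠ 1 := by
  have := Fact.mk hp
  obtain ⟨M, hM, hCM⟩ := (eq_top_or_exists_le_coatom C).resolve_left hC
  have := hQ.isNilpotent
  have hn : M.Normal := Subgroup.NormalizerCondition.normal_of_coatom M
    Group.normalizerCondition_of_isNilpotent hM
  have hne : Nontrivial (Q ⧸ M) := QuotientGroup.nontrivial_iff.2 hM.1
  obtain ⟨k, hk, hcard⟩ := (hQ.to_quotient M).nontrivial_iff_card.1 hne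
  obtain ⟨y, hy⟩ := exists_prime_orderOf_dvd_card' (G := Q ⧸ M) p
    (hcard ▸ dvd_pow_self p hk.ne')
  have hlt : M < (Subgroup.zpowers y).comap (QuotientGroup.mk' M) := by
    refine lt_of_le_of_ne (fun m hm => ?_) fun h => ?_
    · rw [Subgroup.mem_comap, QuotientGroup.mk'_apply, (QuotientGroup.eq_one_iff m).2 hm]
      exact Subgroup.one_mem _
    · obtain ⟨x, rfl⟩ := QuotientGroup.mk'_surjective M y
      have hx : x ∈ M := by
        rw [h]
        exact Subgroup.mem_zpowers _
      rw [QuotientGroup.mk'_apply, (QuotientGroup.eq_one_iff x).2 hx, orderOf_one] at hy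
      exact hp.one_lt.ne hy
  have htop := hM.2 _ hlt
  have hz : Subgroup.zpowers y = ⊤ := by
    rw [← Subgroup.map_comap_eq_self_of_surjective (QuotientGroup.mk'_surjective M)
      (Subgroup.zpowers y), htop, ← MonoidHom.range_eq_map,
      MonoidHom.range_eq_top.2 (QuotientGroup.mk'_surjective M)]
  have hcyc : IsCyclic (Q ⧸ M) := ⟨y, fun z => (hz ▸ Subgroup.mem_top z : z ∈ Subgroup.zpowers y)⟩
  have hcp : Nat.card (Q ⧸ M) = p := by
    rw [← hy, ← Nat.card_zpowers, hz, Subgroup.card_top]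
  let e : Multiplicative (ZMod p) ≃* Q ⧸ M := hcp ▸ zmodCyclicMulEquiv hcyc
  refine ⟨e.symm.toMonoidHom.comp (QuotientGroup.mk' M), fun c hc => ?_, fun h => ?_⟩
  · rw [MonoidHom.mem_ker, MonoidHom.comp_apply, QuotientGroup.mk'_apply,
      (QuotientGroup.eq_one_iff c).2 (hCM hc), map_one]
  · obtain ⟨z, hz⟩ := exists_ne (1 : Q ⧸ M)
    obtain ⟨x, rfl⟩ := QuotientGroup.mk'_surjective M z
    exact hz (e.symm.injective ((DFunLike.congr_fun h x).trans (map_one e.symm).symm))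

theorem IsPGroup.mulAut_eq_one {p r : ℕ} (hp : p.Prime) (hr : r.Prime) (hpr : r ≠ p) {Q : Type*}
    [Group Q] [Finite Q] (hQ : IsPGroup p Q) {φ : MulAut Q} (hφ : φ ^ r = 1)
    (h : ∀ (f : Q →* Multiplicative (ZMod p)) (q : Q), f (φ q) = f q) (q : Q) : φ q = q := by
  have := Fact.mk hp
  have := Fact.mk hr
  have := Fintype.ofFinite Q
  let C : Subgroup Q := φ.toMonoidHom.eqLocus (MonoidHom.id Q)
  by_cases hC : C = ⊤
  · exact (hC ▸ Subgroup.mem_top q : q ∈ C)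
  exfalso
  obtain ⟨f, hf, hf1⟩ := hQ.exists_hom_zmod_of_ne_top hp hC
  obtain ⟨x, hx⟩ : ∃ x, f x ≠ 1 := by
    by_contra! hcon
    exact hf1 (MonoidHom.ext hcon)
  let α := {y : Q // f y = f x}
  let σ : Equiv.Perm α := φ.toEquiv.subtypeEquiv fun y => by
    change f y = f x ↔ f (φ y) = f x
    rw [h]
  have hσ (n : ℕ) (y : α) : (((σ ^ n) y : α) : Q) = (φ ^ n) (y : Q) := by
    induction n with
    | zero => rfl
    | succ n ih =>
      rw [pow_succ', pow_succ', Equiv.Perm.mul_apply, MulAut.mul_apply, ← ih]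
      rfl
  have hcard : Fintype.card α = Nat.card f.ker := by
    rw [← Nat.card_eq_fintype_card]
    refine Nat.card_congr ⟨fun y => ⟨y.1 * x⁻¹, ?_⟩, fun k => ⟨k.1 * x, ?_⟩, fun y => ?_, fun k => ?_⟩
    · rw [MonoidHom.mem_ker, map_mul, y.2, map_inv, mul_inv_cancel]
    · rw [map_mul, MonoidHom.mem_ker.1 k.2, one_mul]
    · exact Subtype.ext (inv_mul_cancel_right _ _)
    · exact Subtype.ext (mul_inv_cancel_right _ _)
  have hnd : ¬ r ∣ Fintype.card α := by
    obtain ⟨k, hk⟩ := IsPGroup.iff_card.1 (hQ.to_subgroup f.ker)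
    rw [hcard, hk]
    exact fun hd => hpr ((Nat.prime_dvd_prime_iff_eq hr hp).1 (hr.dvd_of_dvd_pow hd))
  obtain ⟨y, hy⟩ := Equiv.Perm.exists_fixed_point_of_prime (n := 1) hnd (σ := σ) (by
    ext y
    rw [pow_one, hσ, hφ]
    rfl)
  have hyC : y.1 ∈ C := congrArg Subtype.val hy
  exact hx (y.2.symm.trans (hf hyC))

/-- The conjugation action on the homomorphisms of a normal subgroup to `ZMod p`. -/
noncomputable def homRep (p : ℕ) {X : Type*} [Group X] (Q : Subgroup X) [Q.Normal] :
    Representation (ZMod p) X (Additive Q →+ ZMod p) where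
  toFun x :=
    { toFun := fun f => f.comp (MulAut.conjNormal x⁻¹ : MulAut Q).toMonoidHom.toAdditive
      map_add' := fun _ _ => rfl
      map_smul' := fun _ _ => rfl }
  map_one' := by
    ext f q
    simp
  map_mul' x y := by
    ext f q
    simp

theorem homRep_apply (p : ℕ) {X : Type*} [Group X] (Q : Subgroup X) [hQ : Q.Normal] (x : X)
    (f : Additive Q →+ ZMod p) (q : X) (hq : q ∈ Q) :
    homRep p Q x f (.ofMul ⟨q, hq⟩) =
      f (.ofMul ⟨x⁻¹ * q * x, by simpa using hQ.conj_mem q hq x⁻¹⟩) := by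
  change f (.ofMul (MulAut.conjNormal x⁻¹ ⟨q, hq⟩)) = _
  congr 2
  exact Subtype.ext (by simp)

theorem homRep_eq_one (p : ℕ) {X : Type*} [Group X] (Q : Subgroup X) [hQ : Q.Normal] {x : X}
    (hx : x ∈ Q) : homRep p Q x = 1 := by
  ext f q
  obtain ⟨q, hq⟩ := q
  refine (homRep_apply p Q x f q hq).trans ?_
  have h : (⟨x⁻¹ * q * x, by simpa using hQ.conj_mem q hq x⁻¹⟩ : Q) = ⟨x, hx⟩⁻¹ * ⟨q, hq⟩ * ⟨x, hx⟩ :=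
    rfl
  rw [h, ofMul_mul, ofMul_mul, map_add, map_add, ofMul_inv, map_neg, neg_add_cancel_comm]
  rfl

/-- The representation of the quotient on `Hom(Q, ZMod p)`. -/
noncomputable def quotHomRep (p : ℕ) {X : Type*} [Group X] (Q : Subgroup X) [Q.Normal] :
    Representation (ZMod p) (X ⧸ Q) (Additive Q →+ ZMod p) :=
  QuotientGroup.lift Q (homRep p Q) fun _ hx => homRep_eq_one p Q hx

theorem quotHomRep_faithful {p : ℕ} (hp : p.Prime) {X : Type*} [Group X] [Finite X]
    (Q : Subgroup X) [Q.Normal] (hQ : IsPGroup p Q) (hcent : Subgroup.centralizer (Q : Set X) ≤ Q)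
    {b : X ⧸ Q} (hb : ¬ p ∣ orderOf b) (h : quotHomRep p Q b = 1) : b = 1 := by
  by_contra hb1
  have := Fact.mk hp
  let r := (orderOf b).minFac
  have hr : r.Prime := Nat.minFac_prime (orderOf_eq_one_iff.not.2 hb1)
  have hrb : r ∣ orderOf b := Nat.minFac_dvd _
  have hrp : r ≠ p := fun hrp => hb (hrp ▸ hrb)
  let c := b ^ (orderOf b / r)
  have hc : orderOf c = r := orderOf_pow_orderOf_div (orderOf_pos b).ne' hrb
  obtain ⟨a, ha⟩ := IsPGroup.iff_card.1 hQ
  have hcop : (orderOf c).Coprime (p ^ a) :=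
    hc ▸ ((Nat.coprime_primes hr hp).2 hrp).pow_right a
  obtain ⟨y, hy⟩ := QuotientGroup.mk'_surjective Q c
  let x := y ^ p ^ a
  have hxc : (x : X ⧸ Q) = c ^ p ^ a := by rw [← hy]; rfl
  have hxV : homRep p Q x = 1 := by
    change quotHomRep p Q (x : X ⧸ Q) = 1
    rw [hxc, map_pow, map_pow, h, one_pow, one_pow]
  have hxr : x ^ r = 1 := by
    have : y ^ r ∈ Q := by
      rw [← QuotientGroup.eq_one_iff, QuotientGroup.mk_pow, ← hc]
      exact hy ▸ pow_orderOf_eq_one c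
    rw [← pow_mul, mul_comm, pow_mul, ← ha]
    exact congrArg Subtype.val (pow_card_eq_one' (x := (⟨y ^ r, this⟩ : Q)))
  have hfix := hQ.mulAut_eq_one hp hr hrp (φ := MulAut.conjNormal x⁻¹)
    (by rw [← map_pow, inv_pow, hxr, inv_one, map_one])
    (fun f q => DFunLike.congr_fun (LinearMap.congr_fun hxV f.toAdditiveLeft) (.ofMul q))
  have hxQ : x ∈ Q := hcent (Subgroup.mem_centralizer_iff.2 fun q hq => by
    have := congrArg Subtype.val (hfix ⟨q, hq⟩)
    rw [MulAut.conjNormal_apply, inv_inv] at this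
    change x⁻¹ * q * x = q at this
    rw [mul_assoc, inv_mul_eq_iff_eq_mul] at this
    exact this)
  have hc1 : c ^ p ^ a = 1 := by rw [← hxc, QuotientGroup.eq_one_iff]; exact hxQ
  have := Nat.eq_one_of_dvd_coprimes hcop dvd_rfl (orderOf_dvd_of_pow_eq_one hc1)
  exact hr.one_lt.ne' (hc ▸ this)

section NormSum

variable {F H V : Type*} [CommRing F] [Group H] [AddCommGroup V] [Module F V]

/-- The sum of the operators of a finite subgroup. -/
noncomputable def Representation.normSum (ρ : Representation F H V) (N : Subgroup H) [Fintype N] :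
    Module.End F V :=
  ∑ n : N, ρ n

theorem Representation.normSum_apply (ρ : Representation F H V) (N : Subgroup H) [Fintype N]
    (v : V) : ρ.normSum N v = ∑ n : N, ρ n v := by
  simp [Representation.normSum]

theorem Representation.normSum_mul (ρ : Representation F H V) (N : Subgroup H) [Fintype N]
    [N.Normal] (h : H) : ρ.normSum N * ρ h = ρ h * ρ.normSum N := by
  rw [Representation.normSum, Finset.sum_mul, Finset.mul_sum]
  refine (Fintype.sum_equiv (MulAut.conjNormal h).toEquiv _ _ fun n => ?_).symm
  rw [← map_mul, ← map_mul]
  congr 1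
  change h * (n : H) = (MulAut.conjNormal h n : N) * h
  simp

theorem Representation.mul_normSum_of_mem (ρ : Representation F H V) (N : Subgroup H) [Fintype N]
    {n : H} (hn : n ∈ N) : ρ n * ρ.normSum N = ρ.normSum N := by
  rw [Representation.normSum, Finset.mul_sum]
  refine Fintype.sum_equiv (Equiv.mulLeft (⟨n, hn⟩ : N)) _ _ fun m => ?_
  rw [← map_mul]
  rfl

theorem Representation.normSum_mul_normSum (ρ : Representation F H V) (N : Subgroup H)
    [Fintype N] : ρ.normSum N * ρ.normSum N = (Fintype.card N : F) • ρ.normSum N := by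
  conv_lhs => enter [1]; rw [Representation.normSum]
  rw [Finset.sum_mul, Finset.sum_congr rfl fun n _ => ρ.mul_normSum_of_mem N n.2,
    Finset.sum_const, Finset.card_univ, Nat.cast_smul_eq_nsmul]

end NormSum

theorem Representation.isSemisimpleModule_of_surjective {F H H' V : Type*} [Field F] [Group H]
    [Group H'] [AddCommGroup V] [Module F V] (ρ : Representation F H V)
    (ρ' : Representation F H' V) (q : H →* H') (hq : Function.Surjective q)
    (h : ∀ x, ρ' (q x) = ρ x) (hρ : IsSemisimpleModule (MonoidAlgebra F H) ρ.asModule) :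
    IsSemisimpleModule (MonoidAlgebra F H') ρ'.asModule := by
  rw [← Representation.isSemisimpleRepresentation_iff_isSemisimpleModule_asModule] at hρ ⊢
  let e : Subrepresentation ρ ≃o Subrepresentation ρ' :=
    { toFun := fun S => ⟨S.toSubmodule, fun y v hv => by
        obtain ⟨x, rfl⟩ := hq y
        rw [h]
        exact S.apply_mem_toSubmodule x hv⟩
      invFun := fun S => ⟨S.toSubmodule, fun x v hv => by
        rw [← h]
        exact S.apply_mem_toSubmodule (q x) hv⟩
      left_inv := fun _ => rfl
      right_inv := fun _ => rfl
      map_rel_iff' := Iff.rfl }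
  exact e.complementedLattice_iff.1 hρ

theorem Representation.isSemisimpleModule_ofSubmodule {F H V : Type*} [Field F] [Group H]
    [AddCommGroup V] [Module F V] (ρ : Representation F H V)
    (S : Submodule (MonoidAlgebra F H) ρ.asModule) (hS : IsSemisimpleModule (MonoidAlgebra F H) S) :
    IsSemisimpleModule (MonoidAlgebra F H)
      (Subrepresentation.ofSubmodule' S).toRepresentation.asModule := by
  let σ := (Subrepresentation.ofSubmodule' S).toRepresentation
  have hσ (c : MonoidAlgebra F H) (s : (Subrepresentation.ofSubmodule' S).toSubmodule) :
      ((σ.asAlgebraHom c s : (Subrepresentation.ofSubmodule' S).toSubmodule) : V) =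
        ρ.asAlgebraHom c s := by
    induction c using MonoidAlgebra.induction_linear with
    | zero => simp
    | add x y hx hy => simp [hx, hy]
    | single g a => simp [Representation.asAlgebraHom_single]; rfl
  let l : S →ₗ[MonoidAlgebra F H] σ.asModule :=
    { toFun := fun s => σ.asModuleEquiv.symm ⟨s.1, s.2⟩
      map_add' := fun _ _ => rfl
      map_smul' := fun c s => by
        apply σ.asModuleEquiv.injective
        rw [Representation.asModuleEquiv_map_smul]
        exact Subtype.ext (hσ c ⟨s.1, s.2⟩).symm }
  exact (LinearMap.isSemisimpleModule_iff_of_bijective l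
    ⟨fun a b h => Subtype.ext (congrArg Subtype.val h), fun b => ⟨⟨b.1, b.2⟩, rfl⟩⟩).1 hS

/-- The large-orbit property for groups with a nontrivial normal `p`-complement. -/
def LargeOrbitProperty (p : ℕ) : Prop :=
  ∀ (H : Type) [Group H] [Finite H] (K : Subgroup H) [K.Normal],
    K ≠ ⊥ → Nat.Coprime (Nat.card K) p → IsPGroup p (H ⧸ K) →
    ∀ (P : Sylow p H) (F : Type) [Field F], CharP F p →
      ∀ (V : Type) [AddCommGroup V] [Module F V] [Finite V] (ρ : Representation F H V),
        Function.Injective ρ → IsSemisimpleModule (MonoidAlgebra F H) ρ.asModule →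
        ∃ v : V, (∀ x : H, x ∈ (P : Subgroup H) → ρ x v = v) ∧
          Nat.card {k : K // ρ (k : H) v = v} ^ 2 < Nat.card K

theorem LargeOrbitProperty.of_surjective {p : ℕ} (hp : p.Prime)
    (hQ : LargeOrbitProperty p) {H H' V : Type} [Group H] [Group H'] [Finite H]
    (K : Subgroup H) [hK : K.Normal] (hK1 : K ≠ ⊥) (hKp : Nat.Coprime (Nat.card K) p)
    (hHK : IsPGroup p (H ⧸ K)) (P : Sylow p H) {F : Type} [Field F] [hF : CharP F p]
    [AddCommGroup V] [Module F V] [Finite V] (ρ : Representation F H V)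
    (hfaith : ∀ k ∈ K, ρ k = 1 → k = 1)
    (hss : IsSemisimpleModule (MonoidAlgebra F H) ρ.asModule)
    (q : H →* H') (hq : Function.Surjective q) (ρ' : Representation F H' V)
    (hρ' : ∀ x, ρ' (q x) = ρ x) (hinj : Function.Injective ρ') :
    ∃ v : V, (∀ x ∈ (P : Subgroup H), ρ x v = v) ∧
      Nat.card {k : K // ρ k v = v} ^ 2 < Nat.card K := by
  have := Fact.mk hp
  have hfin : Finite H' := Finite.of_surjective q hq
  have hn : (K.map q).Normal := hK.map q hq
  have hKinj : Function.Injective (q.comp K.subtype) := by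
    rw [injective_iff_map_eq_one]
    intro k hk
    refine Subtype.ext (hfaith k k.2 ?_)
    rw [← hρ', show q k = 1 from hk, map_one]
  let e : K ≃ K.map q := Equiv.ofBijective (fun k => ⟨q k, k, k.2, rfl⟩) ⟨fun a b hab =>
    hKinj (congrArg Subtype.val hab), by rintro ⟨_, k, hk, rfl⟩; exact ⟨⟨k, hk⟩, rfl⟩⟩
  have hcard : Nat.card (K.map q) = Nat.card K := (Nat.card_congr e).symm
  have hq' : IsPGroup p (H' ⧸ K.map q) :=
    hHK.of_surjective (QuotientGroup.map K (K.map q) q (Subgroup.le_comap_map q K)) (by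
      rintro ⟨y⟩
      obtain ⟨x, rfl⟩ := hq y
      exact ⟨(x : H ⧸ K), rfl⟩)
  have hbot : K.map q ≠ ⊥ := fun h => hK1 ((Subgroup.eq_bot_iff_card K).2 (by
    rw [← hcard, h, Subgroup.card_bot]))
  obtain ⟨v, hv, hlt⟩ := hQ H' (K.map q) hbot (hcard ▸ hKp) hq' (P.mapSurjective hq) F hF V ρ' hinj
    (ρ.isSemisimpleModule_of_surjective ρ' q hq hρ' hss)
  refine ⟨v, fun x hx => ?_, ?_⟩
  · rw [← hρ']
    exact hv _ ⟨x, hx, rfl⟩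
  · rw [hcard] at hlt
    rwa [Nat.card_congr (e.subtypeEquiv (q := fun k : K.map q => ρ' k v = v) fun k => by
      change _ ↔ ρ' (q k) v = v
      rw [hρ'])]

theorem LargeOrbitProperty.of_isSemisimpleModule {p : ℕ} (hp : p.Prime)
    (hQ : LargeOrbitProperty p) {H V : Type} [Group H] [Finite H]
    (K : Subgroup H) [hK : K.Normal] (hK1 : K ≠ ⊥) (hKp : Nat.Coprime (Nat.card K) p)
    (hHK : IsPGroup p (H ⧸ K)) (P : Sylow p H) {F : Type} [Field F] [hF : CharP F p]
    [AddCommGroup V] [Module F V] [Finite V] (ρ : Representation F H V)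
    (hfaith : ∀ k ∈ K, ρ k = 1 → k = 1)
    (hss : IsSemisimpleModule (MonoidAlgebra F H) ρ.asModule) :
    ∃ v : V, (∀ x ∈ (P : Subgroup H), ρ x v = v) ∧
      Nat.card {k : K // ρ k v = v} ^ 2 < Nat.card K := by
  let ρ' : Representation F (H ⧸ ρ.ker) V := QuotientGroup.lift ρ.ker ρ fun _ h => h
  have h1 (x : H) : ρ' (QuotientGroup.mk' ρ.ker x) = ρ x := rfl
  have hinj : Function.Injective ρ' := by
    rw [injective_iff_map_eq_one]
    intro y hy
    obtain ⟨x, rfl⟩ := QuotientGroup.mk'_surjective ρ.ker y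
    exact (QuotientGroup.eq_one_iff x).2 hy
  have h2 := QuotientGroup.mk'_surjective ρ.ker
  exact hQ.of_surjective hp K hK1 hKp hHK P ρ hfaith hss _ h2 ρ' h1 hinj

theorem LargeOrbitProperty.of_faithful {p : ℕ} (hp : p.Prime)
    (hQ : LargeOrbitProperty p) {H V : Type} [Group H]
    [Finite H] (K : Subgroup H) [hK : K.Normal] [Fintype K] (hK1 : K ≠ ⊥)
    (hKp : Nat.Coprime (Nat.card K) p)
    (hHK : IsPGroup p (H ⧸ K)) (P : Sylow p H) {F : Type} [Field F] [hF : CharP F p]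
    [AddCommGroup V] [Module F V] [Finite V] (ρ : Representation F H V)
    (hfaith : ∀ k ∈ K, ρ k = 1 → k = 1) :
    ∃ v : V, ρ.normSum K v = 0 ∧ (∀ x ∈ (P : Subgroup H), ρ x v = v) ∧
      Nat.card {k : K // ρ k v = v} ^ 2 < Nat.card K := by
  have hkerinv (N : Subgroup H) [Fintype N] [N.Normal] (h : H) {v : V}
      (hv : v ∈ LinearMap.ker (ρ.normSum N)) : ρ h v ∈ LinearMap.ker (ρ.normSum N) := by
    rw [LinearMap.mem_ker] at hv ⊢
    rw [← Module.End.mul_apply, ρ.normSum_mul, Module.End.mul_apply, hv, map_zero]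
  let V₁ : Submodule (MonoidAlgebra F H) ρ.asModule :=
    Subrepresentation.asSubmodule ⟨LinearMap.ker (ρ.normSum K), fun h _ hv => hkerinv K h hv⟩
  have hV₁ (v : V) : (v : ρ.asModule) ∈ V₁ ↔ ρ.normSum K v = 0 := Iff.rfl
  let S : Submodule (MonoidAlgebra F H) ρ.asModule :=
    ⨆ T ∈ {T : Submodule (MonoidAlgebra F H) ρ.asModule |
      IsSimpleModule (MonoidAlgebra F H) T ∧ T ≤ V₁}, T
  have hS : IsSemisimpleModule (MonoidAlgebra F H) S :=
    isSemisimpleModule_biSup_of_isSemisimpleModule_submodule fun T hT => by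
      have := hT.1
      infer_instance
  have hSV : S ≤ V₁ := iSup₂_le fun T hT => hT.2
  let S' := Subrepresentation.ofSubmodule' S
  let ρS := S'.toRepresentation
  have hρS (h : H) (s : S'.toSubmodule) : ((ρS h s : S'.toSubmodule) : V) = ρ h s := rfl
  have hss : IsSemisimpleModule (MonoidAlgebra F H) ρS.asModule :=
    Representation.isSemisimpleModule_ofSubmodule ρ S hS
  let J : Subgroup H := K ⊓ ρS.ker
  have hJn : J.Normal := inferInstance
  have := Fintype.ofFinite J
  have hcardne (N : Subgroup H) [Fintype N] (hN : N ≤ K) : (Fintype.card N : F) ≠ 0 := by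
    rw [Ne, CharP.cast_eq_zero_iff F p, ← Nat.card_eq_fintype_card]
    exact fun h => (hp.coprime_iff_not_dvd.1 hKp.symm) (h.trans (Subgroup.card_dvd_of_le hN))
  let VJ : Submodule (MonoidAlgebra F H) ρ.asModule :=
    Subrepresentation.asSubmodule ⟨LinearMap.ker (ρ.normSum J), fun h _ hv => hkerinv J h hv⟩
  have hVJ (v : V) : (v : ρ.asModule) ∈ VJ ↔ ρ.normSum J v = 0 := Iff.rfl
  have hJfix (t : V) (h1 : ρ.normSum J t = 0) (h2 : ∀ j : J, ρ (j : H) t = t) : t = 0 := by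
    rw [Representation.normSum_apply, Finset.sum_congr rfl fun j _ => h2 j, Finset.sum_const,
      Finset.card_univ, ← Nat.cast_smul_eq_nsmul F] at h1
    exact (smul_eq_zero.1 h1).resolve_left (hcardne J inf_le_left)
  have hbot : VJ ⊓ V₁ = ⊥ := by
    by_contra hne
    have : Finite ρ.asModule := inferInstanceAs (Finite V)
    obtain ⟨T, hT, hTle⟩ := (eq_bot_or_exists_atom_le (VJ ⊓ V₁)).resolve_left hne
    have hTS : T ≤ S := le_iSup₂_of_le (f := fun T (_ : T ∈ {T : Submodule (MonoidAlgebra F H)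
      ρ.asModule | IsSimpleModule (MonoidAlgebra F H) T ∧ T ≤ V₁}) => T) T
      ⟨isSimpleModule_iff_isAtom.2 hT, hTle.trans inf_le_right⟩ le_rfl
    obtain ⟨t, htT, ht0⟩ := (Submodule.ne_bot_iff T).1 hT.1
    have h1 : ρ.normSum J t = 0 := (hVJ t).1 (hTle htT).1
    have h2 (j : J) : ρ (j : H) t = t :=
      congrArg Subtype.val (LinearMap.congr_fun (MonoidHom.mem_ker.1 j.2.2)
        (⟨t, hTS htT⟩ : S'.toSubmodule))
    exact ht0 (hJfix t h1 h2)
  have hJV₁ (j : H) (hj : j ∈ J) (v : V) (hv : ρ.normSum K v = 0) : ρ j v = v := by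
    have hmem : (ρ j v - v : V) ∈ (VJ ⊓ V₁ : Submodule (MonoidAlgebra F H) ρ.asModule) := by
      refine ⟨(hVJ _).2 ?_, (hV₁ _).2 ?_⟩
      · rw [map_sub, ← Module.End.mul_apply, ρ.normSum_mul, ρ.mul_normSum_of_mem J hj, sub_self]
      · rw [map_sub, ← Module.End.mul_apply, ρ.normSum_mul, Module.End.mul_apply, hv, map_zero,
          sub_zero]
    rw [hbot] at hmem
    exact sub_eq_zero.1 ((Submodule.mem_bot (M := ρ.asModule) (MonoidAlgebra F H)).1 hmem)
  have hJV (j : H) (hj : j ∈ J) : ρ j = 1 := by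
    refine LinearMap.ext fun v => ?_
    have h1 := hJV₁ j hj ((Fintype.card K : F) • v - ρ.normSum K v) (by
      rw [map_sub, ← Module.End.mul_apply, ρ.normSum_mul_normSum, map_smul, LinearMap.smul_apply,
        sub_self])
    rw [map_sub, ← Module.End.mul_apply, ρ.mul_normSum_of_mem K hj.1, sub_left_inj, map_smul] at h1
    exact smul_right_injective V (hcardne K le_rfl) h1
  obtain ⟨v, hv, hlt⟩ := hQ.of_isSemisimpleModule hp K hK1 hKp hHK P ρS
    (fun k hk h => hfaith k hk (hJV k ⟨hk, h⟩)) hss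
  refine ⟨v, (hV₁ _).1 (hSV v.2), fun x hx => congrArg Subtype.val (hv x hx), ?_⟩
  rwa [Nat.card_congr (Equiv.subtypeEquivRight (q := fun k : K => ρS k v = v)
    fun k => by rw [Subtype.ext_iff]; rfl)]

theorem LargeOrbitProperty.exists_fixed {p : ℕ} (hp : p.Prime)
    (hQ : LargeOrbitProperty p) {B V : Type} [Group B]
    [Finite B] (K : Subgroup B) [hK : K.Normal] [Fintype K] (hK1 : K ≠ ⊥)
    (hKp : Nat.Coprime (Nat.card K) p) (P : Sylow p B) {F : Type} [Field F] [hF : CharP F p]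
    [AddCommGroup V] [Module F V] [Finite V] (ρ : Representation F B V)
    (hfaith : ∀ k ∈ K, ρ k = 1 → k = 1) :
    ∃ v : V, ρ.normSum K v = 0 ∧ (∀ x ∈ (P : Subgroup B), ρ x v = v) ∧
      Nat.card {k : K // ρ k v = v} ^ 2 < Nat.card K := by
  have := Fact.mk hp
  let H : Subgroup B := K ⊔ P
  have hKH : K ≤ H := le_sup_left
  let e : K.subgroupOf H ≃ K := (Subgroup.subgroupOfEquivOfLe hKH).toEquiv
  have hcard := Nat.card_congr e
  have := Fintype.ofFinite (K.subgroupOf H)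
  have hPK : IsPGroup p (H ⧸ K.subgroupOf H) := by
    refine P.2.of_surjective ((QuotientGroup.mk' (K.subgroupOf H)).comp
      (Subgroup.inclusion (le_sup_right : (P : Subgroup B) ≤ H))) ?_
    rintro ⟨⟨x, hx⟩⟩
    obtain ⟨k, hk, y, hy, rfl⟩ := Subgroup.mem_sup_of_normal_left.1 hx
    refine ⟨⟨y, hy⟩, QuotientGroup.eq.2 ?_⟩
    rw [Subgroup.mem_subgroupOf]
    have := hK.conj_mem k hk y⁻¹
    simpa [mul_assoc] using this
  obtain ⟨v, h1, h2, h3⟩ := hQ.of_faithful hp (K.subgroupOf H)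
    (fun h => hK1 ((Subgroup.eq_bot_iff_card K).2 (by
      rw [← hcard, h, Subgroup.card_bot])))
    (hcard ▸ hKp) hPK (P.subtype le_sup_right) (ρ.comp H.subtype)
    (fun k hk h => Subtype.ext (hfaith k hk h))
  refine ⟨v, ?_, fun x hx => h2 ⟨x, (le_sup_right : (P : Subgroup B) ≤ H) hx⟩ hx, ?_⟩
  · rw [Representation.normSum_apply] at h1 ⊢
    rw [← h1]
    exact (Fintype.sum_equiv e _ _ fun k => rfl).symm
  · rw [hcard] at h3
    refine lt_of_eq_of_lt (congrArg (· ^ 2) (Nat.card_congr ?_)) h3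
    exact (e.subtypeEquiv (q := fun k : K => ρ k v = v) fun k => Iff.rfl).symm

/-- The stabilizer of `f : Q → ZMod p` under conjugation. -/
def homStabilizer {p : ℕ} {X : Type*} [Group X] {Q : Subgroup X} [Q.Normal]
    (f : Additive Q →+ ZMod p) : Subgroup X where
  carrier := {x | homRep p Q x f = f}
  one_mem' := by simp
  mul_mem' {x y} hx hy := by
    change homRep p Q (x * y) f = f
    rw [map_mul, Module.End.mul_apply, show homRep p Q y f = f from hy,
      show homRep p Q x f = f from hx]
  inv_mem' {x} hx := by
    change homRep p Q x⁻¹ f = f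
    conv_lhs => rw [← show homRep p Q x f = f from hx]
    rw [← Module.End.mul_apply, ← map_mul, inv_mul_cancel, map_one, Module.End.one_apply]

theorem mem_homStabilizer {p : ℕ} {X : Type*} [Group X] {Q : Subgroup X} [Q.Normal]
    {f : Additive Q →+ ZMod p} {x : X} : x ∈ homStabilizer f ↔ homRep p Q x f = f := Iff.rfl

theorem le_homStabilizer {p : ℕ} {X : Type*} [Group X] {Q : Subgroup X} [Q.Normal]
    (f : Additive Q →+ ZMod p) : Q ≤ homStabilizer f := fun x hx => by
  rw [mem_homStabilizer, homRep_eq_one p Q hx, Module.End.one_apply]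

theorem apply_conj_of_mem_homStabilizer {p : ℕ} {X : Type*} [Group X] {Q : Subgroup X}
    [hQ : Q.Normal] {f : Additive Q →+ ZMod p} {x : X} (hx : x ∈ homStabilizer f) (q : X)
    (hq : q ∈ Q) : f (.ofMul ⟨x * q * x⁻¹, hQ.conj_mem q hq x⟩) = f (.ofMul ⟨q, hq⟩) := by
  conv_lhs => rw [← mem_homStabilizer.1 hx]
  rw [homRep_apply]
  congr 2
  exact Subtype.ext (by group)

theorem exists_hom_homStabilizer {p : ℕ} {X : Type*} [Group X] {Q : Subgroup X} [hQ : Q.Normal]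
    (K : Subgroup (X ⧸ Q)) [K.Normal] [Fintype K] (f : Additive Q →+ ZMod p)
    (hf : (quotHomRep p Q).normSum K f = 0) :
    ∃ F : homStabilizer f →* Multiplicative (ZMod p), ∀ (q : X) (hq : q ∈ Q),
      F ⟨q, le_homStabilizer f hq⟩ = .ofAdd (Fintype.card K • f (.ofMul ⟨q, hq⟩)) := by
  choose s hs using fun k : K => QuotientGroup.mk'_surjective Q (k : X ⧸ Q)
  let a (x : X) : MulAut K := MulAut.conjNormal (x : X ⧸ Q)
  have ha (x y : X) (k : K) : a (x * y) k = a x (a y k) := by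
    change MulAut.conjNormal ((x : X ⧸ Q) * (y : X ⧸ Q)) k = _
    rw [map_mul]; rfl
  have hmem (x : X) (k : K) : x * s k * x⁻¹ * (s (a x k))⁻¹ ∈ Q := by
    rw [← QuotientGroup.eq_one_iff]
    change (x : X ⧸ Q) * QuotientGroup.mk' Q (s k) * (x : X ⧸ Q)⁻¹ *
      (QuotientGroup.mk' Q (s (a x k)))⁻¹ = 1
    rw [hs, hs, MulAut.conjNormal_apply, mul_inv_cancel]
  let c (x : X) (k : K) : Q := ⟨_, hmem x k⟩
  let F₀ (x : X) : ZMod p := ∑ k, f (.ofMul (c x k))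
  have hmul (x y : X) (hx : x ∈ homStabilizer f) : F₀ (x * y) = F₀ x + F₀ y := by
    have h1 (k : K) : f (.ofMul (c (x * y) k)) = f (.ofMul (c y k)) + f (.ofMul (c x (a y k))) := by
      rw [← apply_conj_of_mem_homStabilizer hx _ (c y k).2, ← map_add, ← ofMul_mul]
      congr 2
      apply Subtype.ext
      change x * y * s k * (x * y)⁻¹ * (s (a (x * y) k))⁻¹ =
        x * (y * s k * y⁻¹ * (s (a y k))⁻¹) * x⁻¹ * (x * s (a y k) * x⁻¹ * (s (a x (a y k)))⁻¹)
      rw [ha]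
      group
    change ∑ k, _ = _
    rw [Finset.sum_congr rfl fun k _ => h1 k, Finset.sum_add_distrib, add_comm]
    congr 1
    exact Fintype.sum_equiv (a y).toEquiv _ _ fun k => rfl
  refine ⟨MonoidHom.mk' (fun x => .ofAdd (F₀ x)) fun x y => ?_, fun q hq => ?_⟩
  · rw [← ofAdd_add, ← hmul x y x.2]
    rfl
  · change Multiplicative.ofAdd (F₀ q) = _
    congr 1
    have haq (k : K) : a q k = k := by
      change MulAut.conjNormal (q : X ⧸ Q) k = k
      rw [(QuotientGroup.eq_one_iff q).2 hq, map_one]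
      rfl
    have h1 (k : K) : f (.ofMul (c q k)) =
        f (.ofMul ⟨q, hq⟩) - quotHomRep p Q (k⁻¹ : K) f (.ofMul ⟨q, hq⟩) := by
      have h2 : quotHomRep p Q (k⁻¹ : K) = homRep p Q (s k)⁻¹ := by
        rw [Subgroup.coe_inv, ← hs]
        rfl
      rw [h2, homRep_apply, ← map_sub, ← ofMul_div]
      congr 2
      apply Subtype.ext
      change q * s k * q⁻¹ * (s (a q k))⁻¹ = q / ((s k)⁻¹⁻¹ * q * (s k)⁻¹)
      rw [haq, div_eq_mul_inv]
      group
    change ∑ k, _ = _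
    rw [Finset.sum_congr rfl fun k _ => h1 k, Finset.sum_sub_distrib, Finset.sum_const,
      Finset.card_univ]
    rw [Representation.normSum_apply] at hf
    have h3 := DFunLike.congr_fun hf (.ofMul ⟨q, hq⟩)
    rw [AddMonoidHom.finsetSum_apply] at h3
    have h4 : ∑ k : K, quotHomRep p Q (k⁻¹ : K) f (.ofMul ⟨q, hq⟩) = 0 :=
      (Fintype.sum_equiv (Equiv.inv K) _ (fun k : K => quotHomRep p Q k f (.ofMul ⟨q, hq⟩))
        fun k => rfl).trans h3
    rw [h4, sub_zero]

theorem IsSchur.comp_of_surjective {G H V : Type*} [Group G] [Group H] [AddCommGroup V]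
    [Module ℂ V] {ρ : Representation ℂ G V} (hρ : IsSchur ρ) (q : H →* G)
    (hq : Function.Surjective q) : IsSchur (ρ.comp q) :=
  ⟨hρ.1, fun A hA => hρ.2 A fun g => by obtain ⟨h, rfl⟩ := hq g; exact hA h⟩

/-- The conjugation action of `T` on a subgroup `D` that it normalizes. -/
def Subgroup.conjHom {G : Type*} [Group G] (T D : Subgroup G)
    (h : ∀ t ∈ T, ∀ x ∈ D, t * x * t⁻¹ ∈ D) : T →* MulAut D where
  toFun t :=
    { toFun := fun x => ⟨t * x * (t : G)⁻¹, h t t.2 x x.2⟩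
      invFun := fun x => ⟨(t : G)⁻¹ * x * t, by simpa using h _ (T.inv_mem t.2) x x.2⟩
      left_inv := fun x => Subtype.ext (by group)
      right_inv := fun x => Subtype.ext (by group)
      map_mul' := fun x y => Subtype.ext (by
        change (t : G) * (x * y) * (t : G)⁻¹ = t * x * (t : G)⁻¹ * (t * y * (t : G)⁻¹)
        group) }
  map_one' := MulEquiv.ext fun x => Subtype.ext (by
    change ((1 : T) : G) * x * ((1 : T) : G)⁻¹ = x
    simp)
  map_mul' s t := MulEquiv.ext fun x => Subtype.ext (by
    change ((s * t : T) : G) * x * ((s * t : T) : G)⁻¹ = s * (t * x * (t : G)⁻¹) * (s : G)⁻¹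
    rw [Subgroup.coe_mul]
    group)

/-- The inertia group in `T` of a representation of a subgroup normalized by `T`. -/
def inertia {G W : Type*} [Group G] [AddCommGroup W] [Module ℂ W] (T D : Subgroup G)
    (h : ∀ t ∈ T, ∀ x ∈ D, t * x * t⁻¹ ∈ D) (φ : Representation ℂ D W) : Subgroup G where
  carrier := {g | ∃ hg : g ∈ T, ∃ A : (Module.End ℂ W)ˣ, ∀ x : D,
    (A : Module.End ℂ W) * φ x = φ (T.conjHom D h ⟨g, hg⟩ x) * A}
  one_mem' := ⟨T.one_mem, 1, fun x => by
    rw [show (⟨1, T.one_mem⟩ : T) = 1 from rfl, map_one]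
    simp⟩
  mul_mem' := by
    rintro a b ⟨ha, A, hA⟩ ⟨hb, B, hB⟩
    refine ⟨T.mul_mem ha hb, A * B, fun x => ?_⟩
    rw [show (⟨a * b, T.mul_mem ha hb⟩ : T) = ⟨a, ha⟩ * ⟨b, hb⟩ from rfl, map_mul,
      MulAut.mul_apply, Units.val_mul, mul_assoc, hB, ← mul_assoc, hA, mul_assoc]
  inv_mem' := by
    rintro a ⟨ha, A, hA⟩
    refine ⟨T.inv_mem ha, A⁻¹, fun x => ?_⟩
    rw [Units.inv_mul_eq_iff_eq_mul, ← mul_assoc, hA, mul_assoc, Units.mul_inv, mul_one,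
      ← MulAut.mul_apply, ← map_mul, show (⟨a, ha⟩ : T) * ⟨a⁻¹, T.inv_mem ha⟩ = 1 from
        Subtype.ext (mul_inv_cancel a), map_one]
    rfl

theorem inertia_le {G W : Type*} [Group G] [AddCommGroup W] [Module ℂ W] {T D : Subgroup G}
    (h : ∀ t ∈ T, ∀ x ∈ D, t * x * t⁻¹ ∈ D) (φ : Representation ℂ D W) : inertia T D h φ ≤ T :=
  fun _ hg => hg.1

theorem le_inertia {G W : Type*} [Group G] [AddCommGroup W] [Module ℂ W] {T D : Subgroup G}
    (h : ∀ t ∈ T, ∀ x ∈ D, t * x * t⁻¹ ∈ D) (φ : Representation ℂ D W) (hDT : D ≤ T) :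
    D ≤ inertia T D h φ := fun g hg => by
  refine ⟨hDT hg, φ.toHomUnits ⟨g, hg⟩, fun x => ?_⟩
  rw [MonoidHom.coe_toHomUnits, ← map_mul, ← map_mul]
  congr 1
  exact Subtype.ext (inv_mul_cancel_right (g * x : G) g).symm

theorem mul_mem_inertia_eq_zero {G W : Type*} [Group G] [Finite G] [AddCommGroup W] [Module ℂ W]
    [FiniteDimensional ℂ W]
    {T D : Subgroup G} (h : ∀ t ∈ T, ∀ x ∈ D, t * x * t⁻¹ ∈ D) {φ : Representation ℂ D W}
    (hφ : IsSchur φ) {g : G} (hgT : g ∈ T) (hg : g ∉ inertia T D h φ) {B : Module.End ℂ W}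
    (hB : ∀ x : D, B * φ x = φ (T.conjHom D h ⟨g, hgT⟩ x) * B) : B = 0 := by
  by_contra hne
  have h1 : IsSchur (φ.comp (T.conjHom D h ⟨g, hgT⟩).toMonoidHom) :=
    hφ.comp_of_surjective _ (T.conjHom D h ⟨g, hgT⟩).surjective
  obtain ⟨A, rfl⟩ := hφ.isUnit_of_ne_zero h1 hB hne
  exact hg ⟨hgT, A, hB⟩

theorem eq_zero_of_smul_eq_smul {k E : Type*} [Field k] [AddCommGroup E] [Module k E] {a b : k}
    {x : E} (hab : a ≠ b) (h : a • x = b • x) : x = 0 := by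
  rw [← sub_eq_zero, ← sub_smul, smul_eq_zero] at h
  exact h.resolve_left (sub_ne_zero.2 hab)

theorem exists_isSchur_of_inertia {G W Y : Type} [Group G] [Finite G] [AddCommGroup W] [Module ℂ W]
    [FiniteDimensional ℂ W] [AddCommGroup Y] [Module ℂ Y] [FiniteDimensional ℂ Y]
    {Z N T D : Subgroup G} [hN : N.Normal] [hZ : Z.Normal] (hZN : Z ≤ N) (hND : N ≤ D) (hDT : D ≤ T)
    (hTD : ∀ t ∈ T, ∀ x ∈ D, t * x * t⁻¹ ∈ D) (L : N →* ℂˣ)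
    (hL : ∀ g (n : N), L ⟨g * n * g⁻¹, hN.conj_mem n n.2 g⟩ = L n)
    (μ : T →* ℂˣ) (hμZ : ∀ z (hz : z ∈ Z), μ ⟨z, hDT (hND (hZN hz))⟩ = 1)
    (hμ : ∀ g ∉ T, ∃ n, ∃ hn : n ∈ N, μ ⟨g * n * g⁻¹, hDT (hND (hN.conj_mem n hn g))⟩ ≠
      μ ⟨n, hDT (hND hn)⟩)
    {φ : Representation ℂ D W} (hφ : IsSchur φ)
    (hφN : ∀ n : N, φ ⟨n, hND n.2⟩ = (L n : ℂ) • 1)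
    (ρ : Representation ℂ (inertia T D hTD φ) (W ⊗[ℂ] Y)) (hρ : IsSchur ρ)
    (hρD : ∀ x : D, ρ ⟨x, le_inertia hTD φ hDT x.2⟩ = TensorProduct.map (φ x) LinearMap.id) :
    ∃ (V : Type) (_ : AddCommGroup V) (_ : Module ℂ V) (_ : FiniteDimensional ℂ V)
      (σ : Representation ℂ G V), IsSchur σ ∧ (∀ z : Z, σ z = (L ⟨z, hZN z.2⟩ : ℂ) • 1) ∧
      Module.finrank ℂ V =
        (inertia T D hTD φ).index * (Module.finrank ℂ W * Module.finrank ℂ Y) := by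
  let J := inertia T D hTD φ
  have hDJ : D ≤ J := le_inertia hTD φ hDT
  have hJT : J ≤ T := inertia_le hTD φ
  let ψ : Representation ℂ J (W ⊗[ℂ] Y) :=
    { toFun := fun x => (μ ⟨x, hJT x.2⟩ : ℂ) • ρ x
      map_one' := by
        rw [show (⟨((1 : J) : G), hJT (1 : J).2⟩ : T) = 1 from rfl, map_one, map_one]
        simp
      map_mul' := fun x y => by
        rw [show (⟨((x * y : J) : G), hJT (x * y).2⟩ : T) = ⟨x, hJT x.2⟩ * ⟨y, hJT y.2⟩ from rfl,
          map_mul, map_mul, smul_mul_smul_comm, Units.val_mul] }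
  have hψ (x : G) (hx : x ∈ J) : ψ ⟨x, hx⟩ = (μ ⟨x, hJT hx⟩ : ℂ) • ρ ⟨x, hx⟩ := rfl
  have hρN (n : G) (hn : n ∈ N) : ρ ⟨n, hDJ (hND hn)⟩ = (L ⟨n, hn⟩ : ℂ) • 1 := by
    rw [hρD ⟨n, hND hn⟩, hφN ⟨n, hn⟩, TensorProduct.map_smul_left]
    congr 1
    exact TensorProduct.map_id
  have hψS : IsSchur ψ := by
    refine ⟨hρ.1, fun A hA => hρ.2 A fun g => ?_⟩
    have := hA g
    change A * ((μ ⟨g, hJT g.2⟩ : ℂ) • ρ g) = ((μ ⟨g, hJT g.2⟩ : ℂ) • ρ g) * A at this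
    rw [mul_smul_comm, smul_mul_assoc] at this
    exact smul_right_injective _ (Units.ne_zero _) this
  refine ⟨Representation.coindV J.subtype ψ, inferInstance, inferInstance, inferInstance,
    Representation.coind J.subtype ψ, hψS.coind J fun g hg B hB => ?_, fun z => ?_, ?_⟩
  · by_cases hgT : g ∈ T
    · refine tensor_intertwiner_eq_zero (a := φ) (b := fun x => φ (T.conjHom D hTD ⟨g, hgT⟩ x))
        (fun B hB => mul_mem_inertia_eq_zero hTD hφ hgT hg hB) fun x => ?_
      have hgx : g * x * g⁻¹ ∈ D := hTD g hgT x x.2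
      have h1 := hB x (hDJ x.2) (hDJ hgx)
      have h2 : μ ⟨g * x * g⁻¹, hDT hgx⟩ = μ ⟨x, hDT x.2⟩ := by
        rw [show (⟨g * x * g⁻¹, hDT hgx⟩ : T) = ⟨g, hgT⟩ * ⟨x, hDT x.2⟩ * ⟨g, hgT⟩⁻¹ from rfl,
          map_mul, map_mul, map_inv, mul_inv_cancel_comm]
      rw [hψ, hψ, h2, mul_smul_comm, smul_mul_assoc] at h1
      have h3 := smul_right_injective _ (Units.ne_zero _) h1
      rw [hρD, hρD ⟨_, hgx⟩] at h3
      exact h3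
    · obtain ⟨n, hn, hne⟩ := hμ g hgT
      have hgn := hN.conj_mem n hn g
      have h1 := hB n (hDJ (hND hn)) (hDJ (hND hgn))
      rw [hψ, hψ, hρN n hn, hρN _ hgn, hL g ⟨n, hn⟩, mul_smul_comm, smul_mul_assoc, mul_smul_comm,
        smul_mul_assoc, mul_one, one_mul] at h1
      refine LinearMap.ext fun w => ?_
      have h2 : (μ ⟨n, hDT (hND hn)⟩ : ℂ) • (L ⟨n, hn⟩ : ℂ) • B w =
          (μ ⟨g * n * g⁻¹, hDT (hND hgn)⟩ : ℂ) • (L ⟨n, hn⟩ : ℂ) • B w := LinearMap.congr_fun h1 w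
      have h3 := eq_zero_of_smul_eq_smul (fun h => hne (Units.ext h.symm)) h2
      exact (smul_eq_zero.1 h3).resolve_left (Units.ne_zero _)
  · refine LinearMap.ext fun F => Subtype.ext (funext fun h => ?_)
    change F.1 (h * z) = (L ⟨z, hZN z.2⟩ : ℂ) • F.1 h
    have hz' := hZ.conj_mem z z.2 h
    have h1 := F.2 ⟨h * z * h⁻¹, hDJ (hND (hZN hz'))⟩ h
    rw [hψ, hμZ _ hz', hρN _ (hZN hz'), hL h ⟨z, hZN z.2⟩] at h1
    simpa using h1
  · rw [finrank_coindV, Module.finrank_tensorProduct]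

theorem piCore_le_of_sylow_le {p : ℕ} (hp : p.Prime) {Y : Type*} [Group Y] [Finite Y]
    (S : Sylow p Y) : piCore {p} Y ≤ S := by
  have := Fact.mk hp
  have h1 : IsPGroup p (piCore {p} Y) := (isPiNum_singleton_card hp).1 isPiNum_card_piCore
  obtain ⟨S', hS'⟩ := h1.exists_le_sylow
  obtain ⟨g, hg⟩ := MulAction.exists_smul_eq Y S' S
  intro x hx
  rw [← hg, Sylow.coe_subgroup_smul, Subgroup.mem_pointwise_smul_iff_inv_smul_mem]
  apply hS'
  rw [← map_inv, MulAut.smul_def, MulAut.conj_apply]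
  exact (inferInstance : (piCore {p} Y).Normal).conj_mem x hx g⁻¹

theorem exists_degree_eq {p : ℕ} (hp : p.Prime) {G Y : Type} [Group G] [Finite G] [Group Y]
    [Finite Y] (κ : G →* Y) (hκ : Function.Surjective κ) {Z N T D : Subgroup G} [hN : N.Normal]
    [hZ : Z.Normal] (hZN : Z ≤ N) (hND : N ≤ D) (hD : ∀ x, x ∈ D ↔ x ∈ T ∧ κ x = 1)
    (L : N →* ℂˣ) (hL : ∀ g (n : N), L ⟨g * n * g⁻¹, hN.conj_mem n n.2 g⟩ = L n) {m : ℕ}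
    (hm : ¬ p ∣ m) (hLm : ∀ n, L n ^ m = 1) (hDT : D ≤ T)
    (μ : T →* ℂˣ) (hμZ : ∀ z (hz : z ∈ Z), μ ⟨z, hDT (hND (hZN hz))⟩ = 1)
    (hμ : ∀ g ∉ T, ∃ n, ∃ hn : n ∈ N, μ ⟨g * n * g⁻¹, hDT (hND (hN.conj_mem n hn g))⟩ ≠
      μ ⟨n, hDT (hND hn)⟩)
    (P : Sylow p G) (hPT : (P : Subgroup G) ≤ T) (hidx : ¬ p ∣ N.relIndex D)
    (hps : HasPiSections p Y) (hop : piCore {p}ᶜ Y = ⊥)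
    (hC : ∀ n ≤ Nat.card Y, LinearTripleClaim p n) {d : ℕ}
    (hd : ∀ (V : Type) [AddCommGroup V] [Module ℂ V] [FiniteDimensional ℂ V]
      (ρ : Representation ℂ G V), IsSchur ρ → (∀ z : Z, ρ z = (L ⟨z, hZN z.2⟩ : ℂ) • 1) →
      ¬ p ∣ Module.finrank ℂ V → Module.finrank ℂ V = d) :
    ∃ a e : ℕ, ¬ p ∣ a ∧ a ^ 2 ≤ N.relIndex D ∧ ¬ p ∣ d ∧
      d * Nat.card D * p ^ e = a * Nat.card G := by
  have := Fact.mk hp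
  have hTD : ∀ t ∈ T, ∀ x ∈ D, t * x * t⁻¹ ∈ D := fun t ht x hx => by
    rw [hD] at hx ⊢
    exact ⟨T.mul_mem (T.mul_mem ht hx.1) (T.inv_mem ht), by simp [hx.2]⟩
  obtain ⟨W, _, _, _, φ, hφ, hφN, hpW, hW2, hφP⟩ := exists_invariant_isSchur hp P.2 (N.subgroupOf D)
    (L.comp (D.subtype.subgroupComap N)) (fun x n => hL x ⟨n, n.2⟩)
    ((T.conjHom D hTD).comp (Subgroup.inclusion hPT))
    (fun x n => ⟨hN.conj_mem n n.2 x, hL x ⟨n, n.2⟩⟩) hidx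
  have hφN' (n : N) : φ ⟨n, hND n.2⟩ = (L n : ℂ) • 1 := hφN ⟨⟨n, hND n.2⟩, n.2⟩
  let J := inertia T D hTD φ
  have hDJ : D ≤ J := le_inertia hTD φ hDT
  have hPJ : (P : Subgroup G) ≤ J := fun x hx => by
    obtain ⟨A, ⟨A, rfl⟩, hA⟩ := hφP ⟨x, hx⟩
    exact ⟨hPT hx, A, hA⟩
  have hpJ : ¬ p ∣ J.index := fun h => P.not_dvd_index (h.trans (Subgroup.index_dvd_of_le hPJ))
  let f : J →* Y := κ.comp J.subtype
  let q : f.rangeRestrict.ker →* D :=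
    { toFun := fun x => ⟨x, (hD _).2 ⟨inertia_le hTD φ x.1.2, congrArg Subtype.val x.2⟩⟩
      map_one' := rfl
      map_mul' := fun _ _ => rfl }
  have hq : Function.Bijective q := by
    refine ⟨fun x y h => Subtype.ext (Subtype.ext (congrArg (fun z : D => (z : G)) h)), fun x => ?_⟩
    exact ⟨⟨⟨x, hDJ x.2⟩, Subtype.ext ((hD _).1 x.2).2⟩, rfl⟩
  have hR : piCore {p} Y ≤ f.range := by
    refine (piCore_le_of_sylow_le hp (P.mapSurjective hκ)).trans ?_
    rintro _ ⟨x, hx, rfl⟩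
    exact ⟨⟨x, hPJ hx⟩, rfl⟩
  have hdet (x : D) : LinearMap.det (φ x) ^ (N.relIndex D * m) = 1 := by
    have h1 := Subgroup.pow_index_mem (N.subgroupOf D) x
    rw [pow_mul, ← map_pow _ (φ x), ← map_pow φ]
    change LinearMap.det (φ (x ^ (N.subgroupOf D).index)) ^ m = 1
    rw [hφN ⟨_, h1⟩, LinearMap.det_smul, map_one, mul_one, ← pow_mul, mul_comm, pow_mul]
    change (((L ⟨_, h1⟩ : ℂˣ) : ℂ) ^ m) ^ _ = 1
    rw [← Units.val_pow_eq_pow_val, hLm]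
    simp
  have hdim (U : Type) [AddCommGroup U] [Module ℂ U] [FiniteDimensional ℂ U]
      (ρ : Representation ℂ J (W ⊗[ℂ] U)) (hρ : IsSchur ρ)
      (hρD : ∀ z : f.rangeRestrict.ker, ρ z = TensorProduct.map (φ.comp q z) LinearMap.id)
      (hU : ¬ p ∣ Module.finrank ℂ U) :
      J.index * (Module.finrank ℂ W * Module.finrank ℂ U) = d := by
    obtain ⟨V, _, _, _, σ, hσ, hσZ, hV⟩ := exists_isSchur_of_inertia hZN hND hDT hTD L hL μ hμZ hμ
      hφ hφN' ρ hρ fun x => by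
        obtain ⟨y, rfl⟩ := hq.2 x
        exact hρD y
    rw [← hd V σ hσ hσZ, hV]
    rw [hV, hp.dvd_mul, hp.dvd_mul]
    tauto
  have hWpos : 0 < Module.finrank ℂ W := Nat.pos_of_ne_zero fun h => hpW (h ▸ dvd_zero p)
  have hJpos : 0 < J.index := Nat.pos_of_ne_zero fun h => hpJ (h ▸ dvd_zero p)
  obtain ⟨hpR, he⟩ := (hC _ (Nat.card_le_card_of_injective f.range.subtype
    f.range.subtype_injective)).isPGroup hp f.rangeRestrict f.rangeRestrict_surjective
    (φ.comp q) (hφ.comp_of_surjective q hq.2)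
    (fun g => by
      obtain ⟨hg, A, hA⟩ := g.2
      exact ⟨A, A.isUnit, fun z => hA (q z)⟩)
    (N.relIndex D * m) (fun z => hdet (q z))
    (by rw [hp.dvd_mul, hp.dvd_mul]; tauto)
    (hps.of_injective f.range.subtype f.range.subtype_injective)
    (piCore_compl_subgroup_eq_bot hp hps hop _ hR)
    (if J.index * Module.finrank ℂ W ∣ d then d / (J.index * Module.finrank ℂ W) else 0)
    (fun U _ _ _ ρ hρ hρD hU => by
      have h1 := hdim U ρ hρ hρD hU
      rw [← mul_assoc] at h1
      rw [if_pos ⟨_, h1.symm⟩]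
      exact (Nat.div_eq_of_eq_mul_right (by positivity) h1.symm).symm)
  split_ifs at he with hdvd
  have hd' : d = J.index * Module.finrank ℂ W := by rw [← Nat.div_mul_cancel hdvd, he, one_mul]
  obtain ⟨e, he⟩ := IsPGroup.iff_card.1 hpR
  refine ⟨Module.finrank ℂ W, e, hpW, hW2, ?_, ?_⟩
  · rw [hd', hp.dvd_mul]
    tauto
  · have h1 := Subgroup.card_mul_index f.rangeRestrict.ker
    rw [Subgroup.index_ker, MonoidHom.range_eq_top.2 f.rangeRestrict_surjective,
      Subgroup.card_top, he, Nat.card_congr (Equiv.ofBijective q hq)] at h1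
    rw [hd', ← Subgroup.card_mul_index J, ← h1]
    ring

theorem exists_injective_hom_units (p : ℕ) [NeZero p] :
    ∃ ζ : Multiplicative (ZMod p) →* ℂˣ, Function.Injective ζ := by
  refine ⟨(ZMod.stdAddChar (N := p)).toMonoidHom.toHomUnits, fun x y h => ?_⟩
  exact ZMod.injective_stdAddChar (congrArg Units.val h)

theorem relIndex_comap_inf_ker {p : ℕ} {G X : Type} [Group G] [Group X]
    (π : G →* X) (hπ : Function.Surjective π) {Q : Subgroup X} [Q.Normal] (K : Subgroup (X ⧸ Q))
    [K.Normal] (f : Additive Q →+ ZMod p) :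
    (Q.comap π).relIndex ((homStabilizer f).comap π ⊓
      ((QuotientGroup.mk' K).comp ((QuotientGroup.mk' Q).comp π)).ker) =
      Nat.card {k : K // quotHomRep p Q k f = f} := by
  let D := (homStabilizer f).comap π ⊓
      ((QuotientGroup.mk' K).comp ((QuotientGroup.mk' Q).comp π)).ker
  let θ : D →* X ⧸ Q := ((QuotientGroup.mk' Q).comp π).comp D.subtype
  have h1 : (Q.comap π).subgroupOf D = θ.ker := by
    ext x
    exact (QuotientGroup.eq_one_iff (π x)).symm
  have hK (x : G) : ((QuotientGroup.mk' K).comp ((QuotientGroup.mk' Q).comp π)) x = 1 ↔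
      (π x : X ⧸ Q) ∈ K := QuotientGroup.eq_one_iff _
  rw [Subgroup.relIndex, h1, Subgroup.index_ker]
  refine Nat.card_congr
    { toFun := fun x => ⟨⟨x.1, ?_⟩, ?_⟩
      invFun := fun k => ⟨k.1, ?_⟩
      left_inv := fun _ => rfl
      right_inv := fun _ => rfl }
  · obtain ⟨_, x, rfl⟩ := x
    exact (hK x).1 x.2.2
  · obtain ⟨_, x, rfl⟩ := x
    exact x.2.1
  · obtain ⟨⟨k, hk⟩, hkf⟩ := k
    obtain ⟨x, rfl⟩ := QuotientGroup.mk'_surjective Q k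
    obtain ⟨g, rfl⟩ := hπ x
    exact ⟨⟨g, hkf, (hK g).2 hk⟩, rfl⟩

theorem card_fixing_dvd {k B V : Type*} [Field k] [Group B] [AddCommGroup V] [Module k V]
    (ρ : Representation k B V) (K : Subgroup B) (v : V) :
    Nat.card {x : K // ρ x v = v} ∣ Nat.card K := by
  let S : Subgroup K :=
    { carrier := {x | ρ x v = v}
      one_mem' := by simp
      mul_mem' := fun {x y} hx hy => by
        change ρ ((x : B) * y) v = v
        rw [map_mul, Module.End.mul_apply, show ρ y v = v from hy, show ρ x v = v from hx]
      inv_mem' := fun {x} hx => by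
        change ρ (x : B)⁻¹ v = v
        conv_lhs => rw [← show ρ x v = v from hx]
        exact ρ.inv_self_apply x v }
  exact S.card_subgroup_dvd_card

theorem exists_degree_eq_of_hom {p : ℕ} (hp : p.Prime) {G X : Type} [Group G] [Finite G] [Group X]
    [Finite X] (π : G →* X) (hπ : Function.Surjective π) {Q : Subgroup X} [hQ : Q.Normal]
    (K : Subgroup (X ⧸ Q)) [K.Normal] [Fintype K] (hK : ¬ p ∣ Nat.card K)
    (L : Q.comap π →* ℂˣ)
    (hL : ∀ g (n : Q.comap π), L ⟨g * n * g⁻¹, (hQ.comap π).conj_mem n n.2 g⟩ = L n) {m : ℕ}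
    (hm : ¬ p ∣ m) (hLm : ∀ n, L n ^ m = 1)
    (P : Sylow p G) (f : Additive Q →+ ZMod p) (hf : (quotHomRep p Q).normSum K f = 0)
    (hfP : ∀ x ∈ (P : Subgroup G), homRep p Q (π x) f = f)
    (hps : HasPiSections p ((X ⧸ Q) ⧸ K)) (hop : piCore {p}ᶜ ((X ⧸ Q) ⧸ K) = ⊥)
    (hC : ∀ n ≤ Nat.card ((X ⧸ Q) ⧸ K), LinearTripleClaim p n) {d : ℕ}
    (hd : ∀ (V : Type) [AddCommGroup V] [Module ℂ V] [FiniteDimensional ℂ V]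
      (ρ : Representation ℂ G V), IsSchur ρ →
      (∀ z : π.ker, ρ z = (L ⟨z, π.ker_le_comap Q z.2⟩ : ℂ) • 1) →
      ¬ p ∣ Module.finrank ℂ V → Module.finrank ℂ V = d) :
    ∃ a e : ℕ, ¬ p ∣ a ∧ a ^ 2 ≤ Nat.card {k : K // quotHomRep p Q k f = f} ∧ ¬ p ∣ d ∧
      d * Nat.card {k : K // quotHomRep p Q k f = f} * p ^ e = a * Nat.card (X ⧸ Q) := by
  have := Fact.mk hp
  obtain ⟨ζ, hζ⟩ := exists_injective_hom_units p
  obtain ⟨F, hF⟩ := exists_hom_homStabilizer K f hf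
  let T := (homStabilizer f).comap π
  let κ := (QuotientGroup.mk' K).comp ((QuotientGroup.mk' Q).comp π)
  have hκ : Function.Surjective κ := (QuotientGroup.mk'_surjective K).comp
    ((QuotientGroup.mk'_surjective Q).comp hπ)
  have hκ1 (x : G) : κ x = 1 ↔ (π x : X ⧸ Q) ∈ K := QuotientGroup.eq_one_iff _
  have hND : Q.comap π ≤ T ⊓ κ.ker := fun x hx => ⟨le_homStabilizer f hx, (hκ1 x).2 (by
    rw [(QuotientGroup.eq_one_iff (π x)).2 hx]
    exact K.one_mem)⟩
  have hμ (n : G) (hn : n ∈ Q.comap π) (h : n ∈ T) :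
      (F.comp (π.subgroupComap (homStabilizer f))) ⟨n, h⟩ =
        .ofAdd (Fintype.card K • f (.ofMul ⟨π n, hn⟩)) := hF (π n) hn
  have hidx := relIndex_comap_inf_ker (p := p) π hπ K f
  have hKp : (Fintype.card K : ZMod p) ≠ 0 := by
    rwa [Ne, ZMod.natCast_eq_zero_iff, ← Nat.card_eq_fintype_card]
  obtain ⟨a, e, ha, ha2, hd, h⟩ := exists_degree_eq hp κ hκ (π.ker_le_comap Q) hND
    (fun x => Iff.rfl) L hL hm hLm inf_le_left
    (ζ.comp (F.comp (π.subgroupComap (homStabilizer f))))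
    (fun z hz => by
      rw [MonoidHom.comp_apply, hμ z (π.ker_le_comap Q hz)]
      have : (⟨π z, π.ker_le_comap Q hz⟩ : Q) = 1 := Subtype.ext hz
      rw [this]
      simp)
    (fun g hg => by
      have h1 : homRep p Q (π g) f ≠ f := hg
      obtain ⟨⟨q, hq⟩, hne⟩ : ∃ q : Q, homRep p Q (π g) f (.ofMul q) ≠ f (.ofMul q) :=
        DFunLike.ne_iff.1 h1
      rw [homRep_apply] at hne
      obtain ⟨n, hn⟩ := hπ ((π g)⁻¹ * q * π g)
      have hnQ : n ∈ Q.comap π := by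
        rw [Subgroup.mem_comap, hn]
        simpa using hQ.conj_mem q hq (π g)⁻¹
      refine ⟨n, hnQ, fun h => hne ?_⟩
      have h2 := Multiplicative.ofAdd.injective
        ((hμ _ ((hQ.comap π).conj_mem n hnQ g) _).symm.trans ((hζ h).trans (hμ n hnQ _)))
      rw [nsmul_eq_mul, nsmul_eq_mul] at h2
      have h3 := mul_left_cancel₀ hKp h2
      have h4 : (⟨π (g * n * g⁻¹), (hQ.comap π).conj_mem n hnQ g⟩ : Q) = ⟨q, hq⟩ :=
        Subtype.ext (by
          change π (g * n * g⁻¹) = q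
          rw [map_mul, map_mul, hn, map_inv]
          group)
      have h5 : (⟨π n, hnQ⟩ : Q) = ⟨(π g)⁻¹ * q * π g, hn ▸ hnQ⟩ := Subtype.ext hn
      rw [h4, h5] at h3
      exact h3.symm)
    P hfP (by
      rw [hidx]
      exact fun h => hK (h.trans (card_fixing_dvd _ _ _))) hps hop hC hd
  rw [hidx] at ha2
  refine ⟨a, e, ha, ha2, hd, ?_⟩
  have h1 : Nat.card (T ⊓ κ.ker : Subgroup G) = Nat.card (Q.comap π) *
      Nat.card {k : K // quotHomRep p Q k f = f} := by
    rw [← hidx, ← Subgroup.card_mul_index ((Q.comap π).subgroupOf (T ⊓ κ.ker)),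
      Nat.card_congr (Subgroup.subgroupOfEquivOfLe hND).toEquiv]
    rfl
  rw [h1, ← Subgroup.card_mul_index (Q.comap π), Subgroup.index_comap_of_surjective _ hπ] at h
  refine Nat.eq_of_mul_eq_mul_left (Nat.card_pos (α := Q.comap π)) ?_
  rw [← Subgroup.index_eq_card]
  linarith

theorem piCore_quotient_eq_bot {π : Set ℕ} {X : Type*} [Group X] [Finite X] :
    piCore π (X ⧸ piCore π X) = ⊥ := by
  have hsurj := QuotientGroup.mk'_surjective (piCore π X)
  set C := piCore π (X ⧸ piCore π X) with hC
  have h1 := Subgroup.card_mul_index (C.comap (QuotientGroup.mk' (piCore π X)))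
  rw [Subgroup.index_comap_of_surjective _ hsurj,
    ← Subgroup.card_mul_index (piCore π X), Subgroup.index_eq_card (piCore π X),
    ← Subgroup.card_mul_index C, ← mul_assoc] at h1
  have h2 := Nat.eq_of_mul_eq_mul_right (Nat.pos_of_ne_zero C.index_ne_zero_of_finite) h1
  have h3 : C.comap (QuotientGroup.mk' (piCore π X)) ≤ piCore π X :=
    le_piCore inferInstance (h2 ▸ isPiNum_card_piCore.mul isPiNum_card_piCore)
  rw [eq_bot_iff]
  intro x hx
  obtain ⟨y, rfl⟩ := hsurj x
  exact (QuotientGroup.eq_one_iff y).2 (h3 hx)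

theorem eq_of_mul_prime_pow_eq {p : ℕ} (hp : p.Prime) {u v a b : ℕ} (hu : ¬ p ∣ u) (hv : ¬ p ∣ v)
    (h : u * p ^ a = v * p ^ b) : a = b := by
  have := Fact.mk hp
  have hu0 : u ≠ 0 := by rintro rfl; simp at hu
  have hv0 : v ≠ 0 := by rintro rfl; simp at hv
  have hp0 (n : ℕ) : p ^ n ≠ 0 := pow_ne_zero n hp.ne_zero
  have h1 := congrArg (padicValNat p) h
  rwa [padicValNat.mul hu0 (hp0 a), padicValNat.mul hv0 (hp0 b),
    padicValNat.eq_zero_of_not_dvd hu, padicValNat.eq_zero_of_not_dvd hv, padicValNat.prime_pow,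
    padicValNat.prime_pow, zero_add, zero_add] at h1

theorem linearTripleClaim {p : ℕ} (hp : p.Prime) (hQ : LargeOrbitProperty p) (n : ℕ) :
    LinearTripleClaim p n := by
  induction n using Nat.strong_induction_on with
  | _ n ih =>
  intro G X _ _ _ _ π hπ hn l hl m hm hlm hps hop d hd
  subst hn
  by_contra hX
  have := Fact.mk hp
  obtain ⟨Q, hQn, hQp, hcent, hBp⟩ : ∃ (Q : Subgroup X) (_ : Q.Normal), IsPGroup p Q ∧
      Subgroup.centralizer (Q : Set X) ≤ Q ∧ piCore {p} (X ⧸ Q) = ⊥ :=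
    ⟨piCore {p} X, inferInstance, (isPiNum_singleton_card hp).1 isPiNum_card_piCore,
      centralizer_piCore_le hp hps hop, piCore_quotient_eq_bot⟩
  have hQtop : Q ≠ ⊤ := fun h => hX (by
    subst h
    exact hQp.of_equiv Subgroup.topEquiv)
  have : Nontrivial (X ⧸ Q) := QuotientGroup.nontrivial_iff.2 hQtop
  have hpsB : HasPiSections p (X ⧸ Q) :=
    hps.of_surjective (QuotientGroup.mk' Q) (QuotientGroup.mk'_surjective Q)
  obtain ⟨K, hKn, hK1, hKp, hopY⟩ : ∃ (K : Subgroup (X ⧸ Q)) (_ : K.Normal), K ≠ ⊥ ∧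
      ¬ p ∣ Nat.card K ∧ piCore {p}ᶜ ((X ⧸ Q) ⧸ K) = ⊥ :=
    ⟨piCore {p}ᶜ (X ⧸ Q), inferInstance, hpsB.piCore_ne_bot.resolve_left (not_not.2 hBp),
      (isPiNum_compl_singleton hp).1 isPiNum_card_piCore, piCore_quotient_eq_bot⟩
  have := Fintype.ofFinite K
  have hcardY : Nat.card ((X ⧸ Q) ⧸ K) < Nat.card X := by
    have h1 : Nat.card K ≠ 1 := fun h => hK1 (Subgroup.card_eq_one.1 h)
    have h2 : 0 < Nat.card K := Nat.card_pos
    have h3 := Subgroup.card_mul_index K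
    rw [Subgroup.index_eq_card] at h3
    have h4 : Nat.card (X ⧸ Q) ≤ Nat.card X :=
      Nat.card_le_card_of_surjective _ (QuotientGroup.mk'_surjective Q)
    have h5 : 0 < Nat.card ((X ⧸ Q) ⧸ K) := Nat.card_pos
    nlinarith [show 2 ≤ Nat.card K by omega]
  have hker := π.ker_le_comap Q
  have hcop : (π.ker.relIndex (Q.comap π)).Coprime m := by
    obtain ⟨a, ha⟩ := IsPGroup.iff_card.1 hQp
    rw [← MonoidHom.comap_bot, Subgroup.relIndex_comap, Subgroup.map_comap_eq_self_of_surjective hπ,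
      Subgroup.relIndex_bot_left, ha]
    exact Nat.Coprime.pow_left a ((Nat.Prime.coprime_iff_not_dvd hp).2 hm)
  obtain ⟨L, hLZ, hLm⟩ := exists_extension_of_coprime_relIndex π.ker (Q.comap π) hker l hl hlm hcop
  have hL := extension_invariant π.ker (Q.comap π) hker l hl hcop L hLZ hLm
  let P : Sylow p G := default
  have hfaith : ∀ k ∈ K, quotHomRep p Q k = 1 → k = 1 := fun k hk h => by
    refine quotHomRep_faithful hp Q hQp hcent (fun hd => hKp (hd.trans ?_)) h
    rw [← Subgroup.orderOf_mk k hk]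
    exact orderOf_dvd_natCard _
  have : Finite (Additive Q →+ ZMod p) :=
    Finite.of_injective (fun f => (f : Additive Q → ZMod p)) DFunLike.coe_injective
  obtain ⟨f, hf, hfP, hfK⟩ := hQ.exists_fixed hp K hK1
    ((Nat.Prime.coprime_iff_not_dvd hp).2 hKp).symm
    (P.mapSurjective (f := (QuotientGroup.mk' Q).comp π) ((QuotientGroup.mk'_surjective Q).comp hπ))
    (quotHomRep p Q) hfaith
  have key (f : Additive Q →+ ZMod p) (hf : (quotHomRep p Q).normSum K f = 0)
      (hfP : ∀ x ∈ (P : Subgroup G), homRep p Q (π x) f = f) :=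
    exists_degree_eq_of_hom hp π hπ K hKp L hL hm hLm P f hf hfP
      (hpsB.of_surjective (QuotientGroup.mk' K) (QuotientGroup.mk'_surjective K)) hopY
      (fun k hk => ih k (hk.trans_lt hcardY)) (d := d)
      (fun V _ _ _ ρ hρ hρZ => hd V ρ hρ fun z => by rw [hρZ, hLZ])
  obtain ⟨a₀, e₀, ha₀, ha₀', hpd, h₀⟩ := key 0 (map_zero _) (fun _ _ => map_zero _)
  obtain ⟨a, e, ha, ha', -, h⟩ := key f hf fun x hx => hfP _ ⟨x, hx, rfl⟩
  have hc : ¬ p ∣ Nat.card {k : K // quotHomRep p Q k f = f} :=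
    fun h => hKp (h.trans (card_fixing_dvd _ _ _))
  have h0 : Nat.card {k : K // quotHomRep p Q k (0 : Additive Q →+ ZMod p) = 0} = Nat.card K :=
    Nat.card_congr (Equiv.subtypeUnivEquiv fun k => map_zero _)
  rw [h0] at ha₀' h₀
  generalize Nat.card {k : K // quotHomRep p Q k f = f} = c at ha' h hc hfK
  have hb : 0 < Nat.card (X ⧸ Q) := Nat.card_pos
  generalize Nat.card (X ⧸ Q) = b at h h₀ hb
  have hk : 0 < Nat.card K := Nat.card_pos
  generalize Nat.card K = k at ha₀' h₀ hKp hfK hk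
  have hee : e₀ = e := by
    refine eq_of_mul_prime_pow_eq hp (u := d * k * a) (v := d * c * a₀) ?_ ?_ ?_
    · simp only [hp.dvd_mul]; tauto
    · simp only [hp.dvd_mul]; tauto
    · calc d * k * a * p ^ e₀ = d * k * p ^ e₀ * a := by ring
        _ = d * c * p ^ e * a₀ := by rw [h₀, h]; ring
        _ = _ := by ring
  subst hee
  have hapos : 0 < a := Nat.pos_of_ne_zero (by rintro rfl; simp at ha)
  have h1 : a₀ * c = a * k := by
    refine Nat.eq_of_mul_eq_mul_left hb ?_
    calc b * (a₀ * c) = a₀ * b * c := by ring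
      _ = d * c * p ^ e₀ * k := by rw [← h₀]; ring
      _ = b * (a * k) := by rw [h]; ring
  have h2 : k ≤ a₀ * c := h1 ▸ Nat.le_mul_of_pos_left k hapos
  have h3 : k * k ≤ k * c ^ 2 := by
    calc k * k ≤ (a₀ * c) * (a₀ * c) := Nat.mul_le_mul h2 h2
      _ = a₀ ^ 2 * c ^ 2 := by ring
      _ ≤ k * c ^ 2 := Nat.mul_le_mul_right _ ha₀'
  exact absurd (Nat.le_of_mul_le_mul_left h3 hk) (not_le.2 hfK)

theorem IsSchur.sum_trace_mul_trace_inv_ne_zero {Z W : Type*} [Group Z] [Fintype Z] [AddCommGroup W]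
    [Module ℂ W] [FiniteDimensional ℂ W] {lam : Representation ℂ Z W} (h : IsSchur lam) :
    ∑ z, LinearMap.trace ℂ W (lam z) * LinearMap.trace ℂ W (lam z⁻¹) ≠ 0 := by
  have := h.isIrreducible
  have : Invertible (Nat.card Z : ℂ) := invertibleOfNonzero (Nat.cast_ne_zero.2 Nat.card_pos.ne')
  have h1 := Representation.char_orthonormal lam lam
  rw [if_pos ⟨Representation.Equiv.refl lam⟩] at h1
  intro h0
  change _ * ∑ z, LinearMap.trace ℂ W (lam z) * LinearMap.trace ℂ W (lam z⁻¹) = _ at h1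
  rw [h0, mul_zero] at h1
  exact zero_ne_one h1

theorem IsSchur.exists_isUnit_of_trace_eq {Z W : Type*} [Group Z] [Finite Z] [AddCommGroup W]
    [Module ℂ W] [FiniteDimensional ℂ W] {lam σ : Representation ℂ Z W} (h : IsSchur lam)
    (h' : IsSchur σ) (htr : ∀ z, LinearMap.trace ℂ W (σ z) = LinearMap.trace ℂ W (lam z)) :
    ∃ A : Module.End ℂ W, IsUnit A ∧ ∀ z, A * lam z = σ z * A := by
  have := Fintype.ofFinite Z
  have := h.isIrreducible
  have := h'.isIrreducible
  have : Invertible (Nat.card Z : ℂ) := invertibleOfNonzero (Nat.cast_ne_zero.2 Nat.card_pos.ne')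
  have h1 := Representation.char_orthonormal σ lam
  by_cases hne : Nonempty (Representation.Equiv lam σ)
  · obtain ⟨e⟩ := hne
    exact ⟨e.toLinearMap, (Module.End.isUnit_iff _).2 e.toLinearEquiv.bijective, e.1.2⟩
  · rw [if_neg hne, mul_eq_zero, inv_eq_zero] at h1
    have h2 := h1.resolve_left (Nat.cast_ne_zero.2 Nat.card_pos.ne')
    change ∑ z, LinearMap.trace ℂ W (σ z) * LinearMap.trace ℂ W (lam z⁻¹) = _ at h2
    rw [Finset.sum_congr rfl fun z _ => by rw [htr z]] at h2
    exact absurd h2 h.sum_trace_mul_trace_inv_ne_zero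

/-- **Lemma 11.2.**  Let `Z ⊴ G` with `G/Z` `p`-solvable and `O_{p'}(G/Z) = 1`, and let
`λ ∈ Irr(Z)` be `G`-invariant with `o(λ)·λ(1)` prime to `p`.  Assume the large-orbit
property of Question 11.1 holds.  If all irreducible characters of `G` of `p'`-degree
lying over `λ` have the same degree `d`, then `G/Z` is a `p`-group. -/
theorem psolvable_equal_degrees_lemma
    (p : ℕ) (hp : p.Prime)
    (G : Type) [Group G] [Finite G] (Z : Subgroup G) [hZ : Z.Normal]
    -- `λ`: an irreducible complex character of `Z`, afforded by `lam` on `W`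
    (W : Type) [AddCommGroup W] [Module ℂ W] [FiniteDimensional ℂ W]
    (lam : Representation ℂ Z W)
    (hirr : IsSimpleModule (MonoidAlgebra ℂ Z) lam.asModule)
    -- `λ` is `G`-invariant
    (hinv : ∀ (g z : G) (hz : z ∈ Z),
      LinearMap.trace ℂ W (lam ⟨g * z * g⁻¹, hZ.conj_mem z hz g⟩) =
        LinearMap.trace ℂ W (lam ⟨z, hz⟩))
    -- `o(λ)·λ(1)` is not divisible by `p`
    (hord : ¬ p ∣ detOrder lam * Module.finrank ℂ W)
    -- `G/Z` is `p`-solvable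
    (hps : IsPSolvableGroup p (G ⧸ Z))
    -- `O_{p'}(G/Z) = 1`
    (hop : ∀ N : Subgroup (G ⧸ Z), N.Normal → Nat.Coprime (Nat.card N) p → N = ⊥)
    -- the large-orbit property (Question 11.1) holds
    (hQ : ∀ (H : Type) [Group H] [Finite H] (K : Subgroup H) [K.Normal],
      K ≠ ⊥ → Nat.Coprime (Nat.card K) p → IsPGroup p (H ⧸ K) →
      ∀ (P : Sylow p H) (F : Type) [Field F], CharP F p →
        ∀ (V : Type) [AddCommGroup V] [Module F V] [Finite V]
          (ρ : Representation F H V),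
          Function.Injective ρ →
          IsSemisimpleModule (MonoidAlgebra F H) ρ.asModule →
          ∃ v : V, (∀ x : H, x ∈ (P : Subgroup H) → ρ x v = v) ∧
            Nat.card {k : K // ρ (k : H) v = v} ^ 2 < Nat.card K)
    -- all irreducible characters of `G` of `p'`-degree lying over `λ` have degree `d`
    (d : ℕ)
    (hd : ∀ (V : Type) [AddCommGroup V] [Module ℂ V] [FiniteDimensional ℂ V]
        (ρ : Representation ℂ G V),
        IsSimpleModule (MonoidAlgebra ℂ G) ρ.asModule →
        (∑ᶠ z : Z, LinearMap.trace ℂ V (ρ (z : G)) * LinearMap.trace ℂ W (lam z⁻¹)) ≠ 0 →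
        ¬ p ∣ Module.finrank ℂ V → Module.finrank ℂ V = d) :
    IsPGroup p (G ⧸ Z) := by
  have hlam : IsSchur lam := .of_isSimpleModule hirr
  have := Fintype.ofFinite Z
  let q : (QuotientGroup.mk' Z).ker ≃* Z := MulEquiv.subgroupCongr (QuotientGroup.ker_mk' Z)
  have hpW : ¬ p ∣ Module.finrank ℂ W := fun h => hord (h.mul_left _)
  have hWpos : 0 < Module.finrank ℂ W := Nat.pos_of_ne_zero fun h => hpW (h ▸ dvd_zero p)
  have hdet : ∀ z, LinearMap.det (lam z) ^ detOrder lam = 1 := by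
    have hne : {o : ℕ | 0 < o ∧ ∀ z, LinearMap.det (lam z) ^ o = 1}.Nonempty := by
      refine Set.nonempty_iff_ne_empty.2 fun h => hord ?_
      rw [detOrder, h, Nat.sInf_empty, zero_mul]
      exact dvd_zero p
    exact (Nat.sInf_mem hne).2
  refine ((linearTripleClaim hp hQ _).isPGroup hp (QuotientGroup.mk' Z)
    (QuotientGroup.mk'_surjective Z) (lam.comp q.toMonoidHom)
    (hlam.comp_of_surjective _ q.surjective) (fun g => ?_) (detOrder lam) (fun z => hdet (q z))
    hord (hps.hasPiSections hp) (hop _ inferInstance ?_)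
    (d / Module.finrank ℂ W) fun Y _ _ _ ρ hρ hρZ hY => ?_).1
  · let c : MulAut Z := MulAut.conjNormal g
    obtain ⟨A, hA, h⟩ := hlam.exists_isUnit_of_trace_eq
      (hlam.comp_of_surjective c.toMonoidHom c.surjective) fun z => hinv g z z.2
    exact ⟨A, hA, fun z => h (q z)⟩
  · exact ((Nat.Prime.coprime_iff_not_dvd hp).2
      ((isPiNum_compl_singleton hp).1 isPiNum_card_piCore)).symm
  · have hYpos : Module.finrank ℂ Y ≠ 0 := fun h => hY (h ▸ dvd_zero p)
    have h1 := hd (W ⊗[ℂ] Y) ρ hρ.isSimpleModule (by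
      have h2 (z : Z) : LinearMap.trace ℂ (W ⊗[ℂ] Y) (ρ z) =
          LinearMap.trace ℂ W (lam z) * Module.finrank ℂ Y := by
        rw [show ρ z = TensorProduct.map (lam z) LinearMap.id from hρZ (q.symm z),
          LinearMap.trace_tensorProduct', LinearMap.trace_id]
      rw [finsum_eq_sum_of_fintype]
      simp only [h2, mul_right_comm _ (Module.finrank ℂ Y : ℂ), ← Finset.sum_mul]
      exact mul_ne_zero hlam.sum_trace_mul_trace_inv_ne_zero (Nat.cast_ne_zero.2 hYpos)) (by
      rw [Module.finrank_tensorProduct, hp.dvd_mul]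
      tauto)
    rw [Module.finrank_tensorProduct] at h1
    exact (Nat.div_eq_of_eq_mul_right hWpos h1.symm).symm
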